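/- Let G be a strongly balanced connected graph with v(G) ≥ 2 vertices and e(G) edges, and suppose Assumption 1 holds for the subgraph count N_G. Then there exist a constant C > 0 independent of n and an n₀ such that for all n ≥ n₀ and all j ≥ 3, the j-th cumulant of the normalized subgraph count N̄_G := (N_G − E[N_G])/√Var(N_G) satisfies: κ_j(N̄_G) ≤ (j!)^{1+v(G)} / (C n)^{j/2−1} when n^{−(v(G)−1)/e(G)} ≪ p_n, and κ_j(N̄_G) ≤ (j!)^{1+v(G)} / (C n^{v(G)} p_n^{e(G)})^{j/2−1} when p_n ≪ n^{−(v(G)−1)/e(G)}. -/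

import Mathlib

open MeasureTheory Finset ProbabilityTheory

/-- The joint cumulant, via the moment–cumulant formula. -/
noncomputable def jointCumulant {Ω : Type*} [MeasurableSpace Ω] (P : Measure Ω)
    {j : ℕ} (Z : Fin j → Ω → ℝ) : ℝ :=
  ∑ σ : Finpartition (Finset.univ : Finset (Fin j)),
    (-1 : ℝ) ^ (σ.parts.card - 1) * ((σ.parts.card - 1).factorial : ℝ) *
      ∏ b ∈ σ.parts, ∫ ω, ∏ i ∈ b, Z i ω ∂P

/-- The `j`-th cumulant `κ_j(W)` of a random variable `W`. -/
noncomputable def cum {Ω : Type*} [MeasurableSpace Ω] (P : Measure Ω)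
    (j : ℕ) (W : Ω → ℝ) : ℝ :=
  jointCumulant P (fun _ : Fin j => W)

/-- The size `a(G)` of the automorphism group of `G`. -/
noncomputable def autCard {k : ℕ} (G : SimpleGraph (Fin k)) : ℕ := Nat.card (G ≃g G)

/-- The injective subgraph count `N_G` in the binomial random-connection model:
vertices `X_1,…,X_n`, and `X_i ∼ X_j` iff `Y_{i,j} ≤ p_n H(X_i,X_j)` where the
`Y_{i,j}` are i.i.d. uniform on `[0,1]`. -/
noncomputable def NG {d k n : ℕ} {Ω : Type*} (G : SimpleGraph (Fin k)) [DecidableRel G.Adj]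
    (H : (Fin d → ℝ) → (Fin d → ℝ) → ℝ) (pn : ℝ) (aG : ℕ)
    (X : Fin n → Ω → (Fin d → ℝ)) (Y : Fin n → Fin n → Ω → ℝ) (ω : Ω) : ℝ :=
  (aG : ℝ)⁻¹ * ∑ β ∈ (Finset.univ : Finset (Fin k → Fin n)).filter Function.Injective,
    ∏ q ∈ (Finset.univ : Finset (Fin k × Fin k)).filter (fun q => q.1 < q.2 ∧ G.Adj q.1 q.2),
      if Y (β q.1) (β q.2) ω ≤ pn * H (X (β q.1) ω) (X (β q.2) ω) then (1 : ℝ) else 0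

/-- The projection `f_{(ℓ)}` of the subgraph-count functional:
`f_{(ℓ)}(x) = (p^{e(G)}/a(G)) ∫ ∏_{(ı,ȷ)∈E_G} H(x_ı,x_ȷ) dμ^{⊗(k−1)}` with `x_ℓ = x`
(the unused `ℓ`-th coordinate is also integrated out, which is harmless since `μ` is a
probability measure). -/
noncomputable def fSub {d k : ℕ} (G : SimpleGraph (Fin k)) [DecidableRel G.Adj]
    (H : (Fin d → ℝ) → (Fin d → ℝ) → ℝ) (μ : Measure (Fin d → ℝ)) (pn : ℝ) (aG : ℕ)
    (ℓ : Fin k) (x : Fin d → ℝ) : ℝ :=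
  (pn ^ G.edgeFinset.card / (aG : ℝ)) *
    ∫ z : Fin k → (Fin d → ℝ),
      ∏ q ∈ (Finset.univ : Finset (Fin k × Fin k)).filter
          (fun q => q.1 < q.2 ∧ G.Adj q.1 q.2),
        H (Function.update z ℓ x q.1) (Function.update z ℓ x q.2)
      ∂(Measure.pi fun _ => μ)

/-- A graph `G` is strongly balanced if `e(H)/(v(H)−1) ≤ e(G)/(v(G)−1)` for every
subgraph `H` of `G` with at least two vertices. -/
def StronglyBalanced {k : ℕ} (G : SimpleGraph (Fin k)) [DecidableRel G.Adj] : Prop :=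
  ∀ Hs : G.Subgraph, 2 ≤ Hs.verts.ncard →
    Hs.edgeSet.ncard * (k - 1) ≤ G.edgeFinset.card * (Hs.verts.ncard - 1)

/-- The normalized subgraph count `N̄_G = (N_G − E[N_G])/√Var(N_G)`. -/
noncomputable def NGbar {d k n : ℕ} {Ω : Type*} [MeasurableSpace Ω] (P : Measure Ω)
    (G : SimpleGraph (Fin k)) [DecidableRel G.Adj]
    (H : (Fin d → ℝ) → (Fin d → ℝ) → ℝ) (pn : ℝ) (aG : ℕ)
    (X : Fin n → Ω → (Fin d → ℝ)) (Y : Fin n → Fin n → Ω → ℝ) (ω : Ω) : ℝ :=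
  (NG G H pn aG X Y ω - ∫ ω', NG G H pn aG X Y ω' ∂P) /
    Real.sqrt (variance (NG G H pn aG X Y) P)


section Partitions

variable {α : Type*} [Fintype α] [DecidableEq α]

/-- A partition of a finite type together with an injective labelling of its parts in `Fin N`
is the same as a function to `Fin N`. -/
theorem bijective_label_parts (N : ℕ) : Function.Bijective
    (fun (s : Σ σ : Finpartition (univ : Finset α), (σ.parts ↪ Fin N)) (a : α) =>
      s.2 ⟨s.1.part a, s.1.part_mem.2 (mem_univ a)⟩) := by
  constructor
  · rintro ⟨σ, g⟩ ⟨τ, h⟩ hst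
    have hst' : ∀ a, g ⟨σ.part a, σ.part_mem.2 (mem_univ a)⟩ =
      h ⟨τ.part a, τ.part_mem.2 (mem_univ a)⟩ := fun a => congrFun hst a
    have hpart : ∀ a, σ.part a = τ.part a := by
      intro a
      ext b
      rw [σ.mem_part_iff_part_eq_part (mem_univ _) (mem_univ _),
        τ.mem_part_iff_part_eq_part (mem_univ _) (mem_univ _)]
      constructor
      · intro hb
        have : h ⟨τ.part b, τ.part_mem.2 (mem_univ b)⟩ =
            h ⟨τ.part a, τ.part_mem.2 (mem_univ a)⟩ := by
          rw [← hst', ← hst']; congr 1; exact Subtype.ext hb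
        exact congrArg Subtype.val (h.injective this)
      · intro hb
        have : g ⟨σ.part b, σ.part_mem.2 (mem_univ b)⟩ =
            g ⟨σ.part a, σ.part_mem.2 (mem_univ a)⟩ := by
          rw [hst', hst']; congr 1; exact Subtype.ext hb
        exact congrArg Subtype.val (g.injective this)
    have hσ : σ = τ := by
      ext b
      constructor
      · intro hb
        obtain ⟨a, ha⟩ := σ.nonempty_of_mem_parts hb
        rw [← σ.part_eq_of_mem hb ha, hpart]
        exact τ.part_mem.2 (mem_univ a)
      · intro hb
        obtain ⟨a, ha⟩ := τ.nonempty_of_mem_parts hb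
        rw [← τ.part_eq_of_mem hb ha, ← hpart]
        exact σ.part_mem.2 (mem_univ a)
    subst hσ
    congr 1
    ext ⟨b, hb⟩ : 1
    obtain ⟨a, ha⟩ := σ.nonempty_of_mem_parts hb
    have := hst' a
    simpa only [σ.part_eq_of_mem hb ha] using this
  · intro c
    classical
    let σ : Finpartition (univ : Finset α) := Finpartition.ofSetoid (Setoid.ker c)
    have hσ : ∀ a b, b ∈ σ.part a ↔ c a = c b := fun a b => by
      rw [Finpartition.mem_part_ofSetoid_iff_rel]; rfl
    have hne : ∀ b : σ.parts, (b : Finset α).Nonempty := fun b => σ.nonempty_of_mem_parts b.2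
    have hmem : ∀ (b : σ.parts) (x y : α), x ∈ b.1 → (y ∈ b.1 ↔ c x = c y) := by
      intro b x y hx
      rw [← σ.part_eq_of_mem b.2 hx, hσ]
    refine ⟨⟨σ, ⟨fun b => c (hne b).choose, ?_⟩⟩, ?_⟩
    · intro b b' hbb
      have h1 := (hne b).choose_spec
      have h2 := (hne b').choose_spec
      exact Subtype.ext (σ.eq_of_mem_parts b.2 b'.2 ((hmem b _ _ h1).2 hbb) h2)
    · funext a
      have h1 := (hne ⟨σ.part a, σ.part_mem.2 (mem_univ a)⟩).choose_spec
      exact ((hσ _ _).1 h1).symm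

theorem sum_prod_fiber_eq_sum_finpartition (M : Finset α → ℝ) (hM : M ∅ = 1) (N : ℕ) :
    ∑ c : α → Fin N, ∏ v, M (univ.filter fun a => c a = v) =
      ∑ σ : Finpartition (univ : Finset α),
        (N.descFactorial σ.parts.card : ℝ) * ∏ b ∈ σ.parts, M b := by
  classical
  rw [← (bijective_label_parts (α := α) N).sum_comp, Fintype.sum_sigma]
  refine Finset.sum_congr rfl fun σ _ => ?_
  have key : ∀ g : σ.parts ↪ Fin N,
      ∏ v, M (univ.filter fun a => g ⟨σ.part a, σ.part_mem.2 (mem_univ a)⟩ = v) =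
        ∏ b ∈ σ.parts, M b := by
    intro g
    have hfib : ∀ b : σ.parts,
        (univ.filter fun a => g ⟨σ.part a, σ.part_mem.2 (mem_univ a)⟩ = g b) = b.1 := by
      intro b
      ext a
      rw [mem_filter, g.injective.eq_iff, ← σ.part_eq_iff_mem b.2]
      simp [Subtype.ext_iff]
    rw [← Finset.prod_coe_sort σ.parts M]
    have h1 : ∏ v ∈ univ.map g,
        M (univ.filter fun a => g ⟨σ.part a, σ.part_mem.2 (mem_univ a)⟩ = v) =
          ∏ v, M (univ.filter fun a => g ⟨σ.part a, σ.part_mem.2 (mem_univ a)⟩ = v) := by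
      refine Finset.prod_subset (subset_univ _) fun v _ hv => ?_
      rw [Finset.filter_false_of_mem, hM]
      rintro a - rfl
      exact hv (mem_map_of_mem _ (mem_univ _))
    rw [← h1, Finset.prod_map]
    exact Finset.prod_congr rfl fun b _ => by rw [hfib b]
  rw [Finset.sum_congr rfl fun g _ => key g, Finset.sum_const, nsmul_eq_mul, Finset.card_univ,
    Fintype.card_embedding_eq]
  simp

/-- The polynomial whose value at `N` is the moment of a sum of `N` independent copies. -/
noncomputable def partPoly (M : Finset α → ℝ) : Polynomial ℝ :=
  ∑ σ : Finpartition (univ : Finset α),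
    Polynomial.C (∏ b ∈ σ.parts, M b) * descPochhammer ℝ σ.parts.card

/-- The moment-to-cumulant transform of a set function. -/
noncomputable def setCumulant (M : Finset α → ℝ) : ℝ :=
  ∑ σ : Finpartition (univ : Finset α),
    (-1 : ℝ) ^ (σ.parts.card - 1) * ((σ.parts.card - 1).factorial : ℝ) * ∏ b ∈ σ.parts, M b

theorem partPoly_eval_natCast (M : Finset α → ℝ) (hM : M ∅ = 1) (N : ℕ) :
    (partPoly M).eval (N : ℝ) = ∑ c : α → Fin N, ∏ v, M (univ.filter fun a => c a = v) := by
  rw [sum_prod_fiber_eq_sum_finpartition M hM, partPoly, Polynomial.eval_finsetSum]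
  refine Finset.sum_congr rfl fun σ _ => ?_
  rw [Polynomial.eval_mul, Polynomial.eval_C, descPochhammer_eval_eq_descFactorial, mul_comm]

theorem card_parts_pos [Nonempty α] (σ : Finpartition (univ : Finset α)) : 0 < σ.parts.card :=
  Finset.card_pos.2 (σ.parts_nonempty univ_nonempty.ne_empty)

theorem partPoly_eval_zero [Nonempty α] (M : Finset α → ℝ) : (partPoly M).eval 0 = 0 := by
  rw [partPoly, Polynomial.eval_finsetSum]
  refine Finset.sum_eq_zero fun σ _ => ?_
  rw [Polynomial.eval_mul, descPochhammer_ne_zero_eval_zero _ (card_parts_pos σ).ne', mul_zero]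

theorem descPochhammer_eval_neg_one (m : ℕ) :
    (descPochhammer ℝ m).eval (-1) = (-1) ^ m * (m.factorial : ℝ) := by
  induction m with
  | zero => simp
  | succ m ih =>
    rw [descPochhammer_succ_right, Polynomial.eval_mul, ih]
    simp [Nat.factorial_succ, pow_succ]
    ring

theorem derivative_descPochhammer_eval_zero {m : ℕ} (hm : 0 < m) :
    (descPochhammer ℝ m).derivative.eval 0 = (-1) ^ (m - 1) * ((m - 1).factorial : ℝ) := by
  obtain ⟨m, rfl⟩ := Nat.exists_eq_succ_of_ne_zero hm.ne'
  rw [Nat.succ_eq_add_one, descPochhammer_succ_left, Polynomial.derivative_mul]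
  simp [descPochhammer_eval_neg_one]

theorem partPoly_derivative_eval_zero [Nonempty α] (M : Finset α → ℝ) :
    (partPoly M).derivative.eval 0 = setCumulant M := by
  rw [partPoly, Polynomial.derivative_sum, Polynomial.eval_finsetSum, setCumulant]
  refine Finset.sum_congr rfl fun σ _ => ?_
  rw [Polynomial.derivative_C_mul, Polynomial.eval_mul, Polynomial.eval_C,
    derivative_descPochhammer_eval_zero (card_parts_pos σ), mul_comm]

/-- Cumulants vanish when the moments factorize along a nontrivial splitting. -/
theorem setCumulant_eq_zero_of_split (M : Finset α → ℝ) (hM : M ∅ = 1) (A : Finset α)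
    (hA : A.Nonempty) (hA' : A ≠ univ) (hsplit : ∀ b, M b = M (b ∩ A) * M (b \ A)) :
    setCumulant M = 0 := by
  classical
  obtain ⟨a₀, ha₀⟩ := hA
  obtain ⟨b₀, hb₀⟩ : ∃ b, b ∉ A := by
    by_contra! h
    exact hA' (eq_univ_iff_forall.2 h)
  have : Nonempty α := ⟨a₀⟩
  have : Nonempty {a // a ∈ A} := ⟨⟨a₀, ha₀⟩⟩
  have : Nonempty {a // a ∉ A} := ⟨⟨b₀, hb₀⟩⟩
  let M₁ : Finset {a // a ∈ A} → ℝ := fun b => M (b.map (Function.Embedding.subtype _))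
  let M₂ : Finset {a // a ∉ A} → ℝ := fun b => M (b.map (Function.Embedding.subtype _))
  have hprod : partPoly M = partPoly M₁ * partPoly M₂ := by
    refine Polynomial.eq_of_infinite_eval_eq _ _
      (Set.Infinite.mono ?_ (Set.infinite_range_of_injective (Nat.cast_injective (R := ℝ))))
    rintro _ ⟨N, rfl⟩
    simp only [Set.mem_ofPred_eq]
    rw [Polynomial.eval_mul, partPoly_eval_natCast M hM, partPoly_eval_natCast M₁ (by simpa [M₁]),
      partPoly_eval_natCast M₂ (by simpa [M₂]), Finset.sum_mul_sum, ← Finset.sum_product',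
      Finset.univ_product_univ]
    refine Fintype.sum_equiv (Equiv.piEquivPiSubtypeProd (fun a => a ∈ A) fun _ => Fin N) _ _ ?_
    intro c
    rw [← Finset.prod_mul_distrib]
    refine Finset.prod_congr rfl fun v _ => ?_
    rw [hsplit]
    congr 1
    · simp only [M₁]
      congr 1
      ext a
      simp [Equiv.piEquivPiSubtypeProd, and_comm]
    · simp only [M₂]
      congr 1
      ext a
      simp [Equiv.piEquivPiSubtypeProd, and_comm]
  rw [← partPoly_derivative_eval_zero, hprod, Polynomial.derivative_mul]
  simp [partPoly_eval_zero]

theorem sum_descFactorial_card_parts (N : ℕ) :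
    ∑ σ : Finpartition (univ : Finset α), (N.descFactorial σ.parts.card : ℝ) =
      (N : ℝ) ^ Fintype.card α := by
  have := sum_prod_fiber_eq_sum_finpartition (α := α) (fun _ => 1) rfl N
  simpa using this.symm

theorem card_parts_le (σ : Finpartition (univ : Finset α)) :
    σ.parts.card ≤ Fintype.card α := σ.card_parts_le_card

theorem sum_factorial_card_parts_le :
    ∑ σ : Finpartition (univ : Finset α), ((σ.parts.card - 1).factorial : ℝ) ≤
      (Fintype.card α : ℝ) ^ Fintype.card α := by
  rw [← sum_descFactorial_card_parts]
  refine Finset.sum_le_sum fun σ _ => ?_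
  have h : (σ.parts.card - 1).factorial ≤ (Fintype.card α).descFactorial σ.parts.card :=
    calc (σ.parts.card - 1).factorial ≤ σ.parts.card.factorial :=
          Nat.factorial_le (Nat.sub_le _ _)
      _ = σ.parts.card.descFactorial σ.parts.card := (Nat.descFactorial_self _).symm
      _ ≤ _ := Nat.descFactorial_le _ (card_parts_le σ)
  exact_mod_cast h

/-- A cumulant is bounded by any common bound on the products of moments, up to `|α|^|α|`. -/
theorem abs_setCumulant_le (M : Finset α → ℝ) (K : ℝ)
    (hK : ∀ σ : Finpartition (univ : Finset α), |∏ b ∈ σ.parts, M b| ≤ K) :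
    |setCumulant M| ≤ (Fintype.card α : ℝ) ^ Fintype.card α * K := by
  have hK0 : 0 ≤ K := (abs_nonneg _).trans (hK ⊥)
  calc |setCumulant M|
      ≤ ∑ σ : Finpartition (univ : Finset α),
          |(-1 : ℝ) ^ (σ.parts.card - 1) * ((σ.parts.card - 1).factorial : ℝ) *
            ∏ b ∈ σ.parts, M b| := Finset.abs_sum_le_sum_abs _ _
    _ ≤ ∑ σ : Finpartition (univ : Finset α), ((σ.parts.card - 1).factorial : ℝ) * K := by
        refine Finset.sum_le_sum fun σ _ => ?_
        rw [abs_mul, abs_mul, abs_pow, abs_neg, abs_one, one_pow, one_mul, Nat.abs_cast]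
        exact mul_le_mul_of_nonneg_left (hK σ) (Nat.cast_nonneg _)
    _ ≤ _ := by
        rw [← Finset.sum_mul]
        exact mul_le_mul_of_nonneg_right sum_factorial_card_parts_le hK0

/-- Functions to `Fin n` weighted by `n` to minus the size of their image. -/
theorem sum_inv_pow_card_image_le (n : ℕ) :
    ∑ c : α → Fin n, ((n : ℝ)⁻¹) ^ (univ.image c).card ≤
      (Fintype.card α : ℝ) ^ Fintype.card α := by
  have h := sum_prod_fiber_eq_sum_finpartition (α := α)
    (fun b => if b = ∅ then 1 else (n : ℝ)⁻¹) (by simp) n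
  have h1 : ∀ c : α → Fin n, ∏ v, (if (univ.filter fun a => c a = v) = ∅ then 1 else (n : ℝ)⁻¹) =
      ((n : ℝ)⁻¹) ^ (univ.image c).card := by
    intro c
    rw [Finset.prod_ite, Finset.prod_const_one, one_mul, Finset.prod_const]
    congr 2
    ext v
    simp [Finset.filter_eq_empty_iff]
  rw [Finset.sum_congr rfl fun c _ => h1 c] at h
  rw [h, ← sum_descFactorial_card_parts]
  refine Finset.sum_le_sum fun σ _ => ?_
  rw [Finset.prod_congr rfl fun b hb => if_neg (σ.ne_empty hb), Finset.prod_const]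
  have h2 : (n.descFactorial σ.parts.card : ℝ) ≤ (n : ℝ) ^ σ.parts.card := by
    exact_mod_cast Nat.descFactorial_le_pow _ _
  have h3 : (1 : ℝ) ≤ ((Fintype.card α).descFactorial σ.parts.card : ℝ) := by
    exact_mod_cast Nat.descFactorial_pos.2 (card_parts_le σ)
  refine le_trans ?_ h3
  calc (n.descFactorial σ.parts.card : ℝ) * ((n : ℝ)⁻¹) ^ σ.parts.card
      ≤ (n : ℝ) ^ σ.parts.card * ((n : ℝ)⁻¹) ^ σ.parts.card := by gcongr
    _ = ((n : ℝ) * (n : ℝ)⁻¹) ^ σ.parts.card := (mul_pow _ _ _).symm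
    _ ≤ 1 := pow_le_one₀ (by positivity) mul_inv_le_one

end Partitions

section Multilinear

theorem prod_parts_attach {α : Type*} [Fintype α] [DecidableEq α]
    (σ : Finpartition (univ : Finset α)) (g : α → σ.parts → ℝ) :
    ∏ b : σ.parts, ∏ i ∈ b.1, g i b = ∏ i, g i ⟨σ.part i, σ.part_mem.2 (mem_univ i)⟩ := by
  rw [← Finset.prod_fiberwise_of_maps_to
    (g := fun i => (⟨σ.part i, σ.part_mem.2 (mem_univ i)⟩ : σ.parts)) (t := univ)
    (fun _ _ => mem_univ _)]
  refine Finset.prod_congr rfl fun b _ => ?_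
  have hb : (univ.filter fun i => (⟨σ.part i, σ.part_mem.2 (mem_univ i)⟩ : σ.parts) = b) = b.1 := by
    ext i
    rw [mem_filter, ← σ.part_eq_iff_mem b.2]
    simp [Subtype.ext_iff]
  rw [hb]
  refine Finset.prod_congr rfl fun i hi => ?_
  congr 1
  exact Subtype.ext (σ.part_eq_of_mem b.2 hi).symm

/-- Multilinearity of cumulants. -/
theorem cum_sum {Ω ι : Type*} [MeasurableSpace Ω] [Fintype ι] [DecidableEq ι]
    (P : Measure Ω) [IsProbabilityMeasure P] (j : ℕ) (Z : ι → Ω → ℝ)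
    (hZ : ∀ (f : Fin j → ι) (b : Finset (Fin j)), Integrable (fun ω => ∏ i ∈ b, Z (f i) ω) P) :
    cum P j (fun ω => ∑ β, Z β ω) =
      ∑ f : Fin j → ι, setCumulant (fun b => ∫ ω, ∏ i ∈ b, Z (f i) ω ∂P) := by
  unfold cum jointCumulant setCumulant
  rw [Finset.sum_comm]
  refine Finset.sum_congr rfl fun σ _ => ?_
  rw [← Finset.mul_sum]
  congr 1
  have h1 : ∀ F : Finset (Fin j) → Ω → ℝ, ∏ b ∈ σ.parts, ∫ ω, F b ω ∂P =
      ∫ w : σ.parts → Ω, ∏ b : σ.parts, F b.1 (w b) ∂(Measure.pi fun _ => P) := by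
    intro F
    rw [integral_fintype_prod_eq_prod (fun b : σ.parts => F b.1),
      Finset.prod_coe_sort σ.parts (fun b => ∫ ω, F b ω ∂P)]
  rw [h1, Finset.sum_congr rfl fun f _ => h1 _, ← integral_finsetSum]
  · congr 1
    funext w
    rw [prod_parts_attach σ (fun _ b => ∑ β, Z β (w b)), Fintype.prod_sum]
    refine Finset.sum_congr rfl fun f _ => ?_
    rw [prod_parts_attach σ (fun i b => Z (f i) (w b))]
  · intro f _
    exact Integrable.fintype_prod (fun b : σ.parts => hZ f b.1)

theorem setCumulant_smul {α : Type*} [Fintype α] [DecidableEq α] (c : α → ℝ)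
    (M : Finset α → ℝ) :
    setCumulant (fun b => (∏ i ∈ b, c i) * M b) = (∏ i, c i) * setCumulant M := by
  unfold setCumulant
  rw [Finset.mul_sum]
  refine Finset.sum_congr rfl fun σ _ => ?_
  have h : ∏ b ∈ σ.parts, ∏ i ∈ b, c i = ∏ i, c i := by
    rw [← Finset.prod_coe_sort σ.parts (fun b => ∏ i ∈ b, c i)]
    exact prod_parts_attach σ (fun i _ => c i)
  rw [Finset.prod_mul_distrib, h]
  ring

end Multilinear

section ProductMeasure

variable {ι E : Type*} [Fintype ι] [MeasurableSpace E] (μ : Measure E) [IsProbabilityMeasure μ]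

/-- Functions of disjoint sets of coordinates are uncorrelated under a product measure. -/
theorem integral_mul_of_dependsOn {φ ψ : (ι → E) → ℝ} {S T : Set ι}
    (hφ : DependsOn φ S) (hψ : DependsOn ψ T) (hST : Disjoint S T) :
    ∫ x, φ x * ψ x ∂(Measure.pi fun _ : ι => μ) =
      (∫ x, φ x ∂(Measure.pi fun _ : ι => μ)) * ∫ x, ψ x ∂(Measure.pi fun _ : ι => μ) := by
  classical
  obtain ⟨z⟩ : Nonempty E := nonempty_of_isProbabilityMeasure μ
  have hT : DependsOn ψ Sᶜ := fun x y h =>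
    hψ fun i hi => h i (Set.disjoint_right.1 hST hi)
  have mp := measurePreserving_piEquivPiSubtypeProd (fun _ : ι => μ) (fun i => i ∈ S)
  let φ' : ({i // i ∈ S} → E) → ℝ := fun u => φ fun i => if h : i ∈ S then u ⟨i, h⟩ else z
  let ψ' : ({i // i ∉ S} → E) → ℝ := fun v => ψ fun i => if h : i ∈ S then z else v ⟨i, h⟩
  have hφ' : ∀ x, φ x = φ' (MeasurableEquiv.piEquivPiSubtypeProd (fun _ => E) (· ∈ S) x).1 := by
    intro x
    refine hφ fun i hi => ?_
    simp [hi, MeasurableEquiv.piEquivPiSubtypeProd, Equiv.piEquivPiSubtypeProd]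
  have hψ' : ∀ x, ψ x = ψ' (MeasurableEquiv.piEquivPiSubtypeProd (fun _ => E) (· ∈ S) x).2 := by
    intro x
    refine hT fun i hi => ?_
    have : i ∉ S := hi
    simp [this, MeasurableEquiv.piEquivPiSubtypeProd, Equiv.piEquivPiSubtypeProd]
  have key : ∀ (f : ({i // i ∈ S} → E) → ℝ) (g : ({i // i ∉ S} → E) → ℝ),
      ∫ x, f (MeasurableEquiv.piEquivPiSubtypeProd (fun _ => E) (· ∈ S) x).1 *
        g (MeasurableEquiv.piEquivPiSubtypeProd (fun _ => E) (· ∈ S) x).2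
          ∂(Measure.pi fun _ : ι => μ) =
        (∫ u, f u ∂(Measure.pi fun _ => μ)) * ∫ v, g v ∂(Measure.pi fun _ => μ) := by
    intro f g
    rw [← integral_prod_mul f g, ← mp.map_eq, integral_map_equiv]
  have h1 := key φ' ψ'
  have h2 := key φ' (fun _ => 1)
  have h3 := key (fun _ => 1) ψ'
  simp only [mul_one, one_mul, integral_const, probReal_univ, smul_eq_mul] at h2 h3
  simp_rw [hφ', hψ']
  rw [h1, h2, h3]

theorem measurePreserving_precomp {κ : Type*} [Fintype κ] (β : κ → ι)
    (hβ : Function.Injective β) :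
    MeasurePreserving (fun (x : ι → E) (a : κ) => x (β a))
      (Measure.pi fun _ : ι => μ) (Measure.pi fun _ : κ => μ) := by
  refine ⟨by fun_prop, ?_⟩
  have h := (iIndepFun_pi (μ := fun _ : ι => μ) (X := fun _ => id)
    (fun _ => aemeasurable_id)).precomp hβ
  have h2 := h.map_fun_eq_pi_map (fun a => (measurable_pi_apply (β a)).aemeasurable)
  change Measure.map (fun (x : ι → E) a => x (β a)) _ = _ at h2
  rw [h2]
  congr 1
  funext a
  exact (measurePreserving_eval (fun _ : ι => μ) (β a)).map_eq

variable {μ} in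
theorem integral_eval_pi {φ : E → ℝ} (hφ : Measurable φ) (i : ι) :
    ∫ x, φ (x i) ∂(Measure.pi fun _ : ι => μ) = ∫ x, φ x ∂μ := by
  have mp := measurePreserving_eval (fun _ : ι => μ) i
  have := integral_map (μ := Measure.pi fun _ : ι => μ) mp.measurable.aemeasurable
    (f := φ) hφ.aestronglyMeasurable
  rw [mp.map_eq] at this
  exact this.symm

theorem measurePreserving_update [DecidableEq ι] (ℓ : ι) :
    MeasurePreserving (fun w : (ι → E) × E => Function.update w.1 ℓ w.2)
      ((Measure.pi fun _ : ι => μ).prod μ) (Measure.pi fun _ : ι => μ) := by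
  have hm : Measurable fun w : (ι → E) × E => Function.update w.1 ℓ w.2 := by
    refine measurable_pi_iff.2 fun i => ?_
    by_cases hi : i = ℓ
    · subst hi
      simpa using measurable_snd
    · simp only [Function.update_of_ne hi]
      exact (measurable_pi_apply i).comp measurable_fst
  refine ⟨hm, ?_⟩
  refine (Measure.pi_eq fun s hs => ?_).symm
  rw [Measure.map_apply hm (MeasurableSet.univ_pi hs)]
  have : (fun w : (ι → E) × E => Function.update w.1 ℓ w.2) ⁻¹' Set.univ.pi s =
      (Set.univ.pi (Function.update s ℓ Set.univ)) ×ˢ s ℓ := by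
    ext ⟨x, y⟩
    simp only [Set.mem_preimage, Set.mem_pi, Set.mem_univ, true_implies, Set.mem_prod]
    constructor
    · intro h
      refine ⟨fun i => ?_, by simpa using h ℓ⟩
      by_cases hi : i = ℓ
      · subst hi; simp
      · simpa [hi] using h i
    · rintro ⟨h1, h2⟩ i
      by_cases hi : i = ℓ
      · subst hi; simpa
      · simpa [hi] using h1 i
  rw [this, Measure.prod_prod, Measure.pi_pi, ← Finset.mul_prod_erase univ _ (mem_univ ℓ),
    ← Finset.mul_prod_erase univ (fun i => μ (s i)) (mem_univ ℓ), mul_comm]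
  congr 1
  simp only [Function.update_self, measure_univ, one_mul]
  refine Finset.prod_congr rfl fun i hi => ?_
  rw [Function.update_of_ne (Finset.ne_of_mem_erase hi)]

end ProductMeasure

section Edges

variable {V E Ω : Type*}

/-- The connection function evaluated at an edge. -/
noncomputable def edgeWeight (H : E → E → ℝ) (e : Sym2 V) (x : V → E) : ℝ :=
  H (x (Quot.out e : V × V).1) (x (Quot.out e : V × V).2)

/-- The indicator that an edge is present. -/
noncomputable def edgeInd (H : E → E → ℝ) (p : ℝ) (X : V → Ω → E) (Y : V → V → Ω → ℝ)
    (e : Sym2 V) (ω : Ω) : ℝ :=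
  if Y (Quot.out e : V × V).1 (Quot.out e : V × V).2 ω ≤
    p * edgeWeight H e (fun i => X i ω) then 1 else 0

theorem out_mk (a b : V) :
    (Quot.out s(a, b) : V × V) = (a, b) ∨ (Quot.out s(a, b) : V × V) = (b, a) := by
  have h : s((Quot.out s(a, b) : V × V).1, (Quot.out s(a, b) : V × V).2) = s(a, b) := by
    exact Quot.out_eq s(a, b)
  rw [Sym2.eq_iff] at h
  rcases h with ⟨h1, h2⟩ | ⟨h1, h2⟩
  · exact Or.inl (Prod.ext h1 h2)
  · exact Or.inr (Prod.ext h1 h2)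

theorem edgeWeight_mk {H : E → E → ℝ} (hH : ∀ x y, H x y = H y x) (a b : V) (x : V → E) :
    edgeWeight H s(a, b) x = H (x a) (x b) := by
  unfold edgeWeight
  rcases out_mk a b with h | h
  · simp [h]
  · simp only [h]; exact hH _ _

theorem edgeInd_mk {H : E → E → ℝ} (hH : ∀ x y, H x y = H y x) (p : ℝ) (X : V → Ω → E)
    {Y : V → V → Ω → ℝ} (hY : ∀ a b, Y a b = Y b a) (a b : V) (ω : Ω) :
    edgeInd H p X Y s(a, b) ω = if Y a b ω ≤ p * H (X a ω) (X b ω) then 1 else 0 := by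
  unfold edgeInd
  rw [edgeWeight_mk hH]
  rcases out_mk a b with h | h
  · simp [h]
  · simp only [h]; rw [hY b a]

theorem edgeWeight_mem_Icc {H : E → E → ℝ} (hH : ∀ x y, H x y ∈ Set.Icc (0 : ℝ) 1)
    (e : Sym2 V) (x : V → E) : edgeWeight H e x ∈ Set.Icc (0 : ℝ) 1 := hH _ _

theorem prod_edgeWeight_mem_Icc {H : E → E → ℝ} (hH : ∀ x y, H x y ∈ Set.Icc (0 : ℝ) 1)
    (U : Finset (Sym2 V)) (x : V → E) : ∏ e ∈ U, edgeWeight H e x ∈ Set.Icc (0 : ℝ) 1 :=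
  ⟨Finset.prod_nonneg fun e _ => (edgeWeight_mem_Icc hH e x).1,
    Finset.prod_le_one (fun e _ => (edgeWeight_mem_Icc hH e x).1)
      fun e _ => (edgeWeight_mem_Icc hH e x).2⟩

theorem dependsOn_edgeWeight (H : E → E → ℝ) (e : Sym2 V) :
    DependsOn (edgeWeight H e : (V → E) → ℝ) {v | v ∈ e} := by
  intro x y hxy
  have h : s((Quot.out e : V × V).1, (Quot.out e : V × V).2) = e := Quot.out_eq e
  have h1 := Sym2.mem_mk_left (Quot.out e : V × V).1 (Quot.out e : V × V).2
  have h2 := Sym2.mem_mk_right (Quot.out e : V × V).1 (Quot.out e : V × V).2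
  rw [h] at h1 h2
  unfold edgeWeight
  rw [hxy _ h1, hxy _ h2]

theorem dependsOn_prod_edgeWeight (H : E → E → ℝ) {U : Finset (Sym2 V)} {S : Set V}
    (hU : ∀ e ∈ U, ∀ v ∈ e, v ∈ S) :
    DependsOn (fun x : V → E => ∏ e ∈ U, edgeWeight H e x) S := by
  intro x y hxy
  exact Finset.prod_congr rfl fun e he =>
    dependsOn_edgeWeight H e fun v hv => hxy v (hU e he v hv)

theorem edgeInd_nonneg (H : E → E → ℝ) (p : ℝ) (X : V → Ω → E) (Y : V → V → Ω → ℝ)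
    (e : Sym2 V) (ω : Ω) : 0 ≤ edgeInd H p X Y e ω := by
  unfold edgeInd; split_ifs <;> norm_num

theorem edgeInd_le_one (H : E → E → ℝ) (p : ℝ) (X : V → Ω → E) (Y : V → V → Ω → ℝ)
    (e : Sym2 V) (ω : Ω) : edgeInd H p X Y e ω ≤ 1 := by
  unfold edgeInd; split_ifs <;> norm_num

theorem edgeInd_mul_self (H : E → E → ℝ) (p : ℝ) (X : V → Ω → E) (Y : V → V → Ω → ℝ)
    (e : Sym2 V) (ω : Ω) : edgeInd H p X Y e ω * edgeInd H p X Y e ω = edgeInd H p X Y e ω := by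
  unfold edgeInd; split_ifs <;> norm_num

theorem prod_idem_union {κ : Type*} [DecidableEq κ] (g : κ → ℝ) (hg : ∀ e, g e * g e = g e)
    (s t : Finset κ) : (∏ e ∈ s, g e) * ∏ e ∈ t, g e = ∏ e ∈ s ∪ t, g e := by
  classical
  induction t using Finset.induction_on with
  | empty => simp
  | insert a t ha ih =>
    rw [prod_insert ha, Finset.union_insert, mul_left_comm, ih]
    by_cases h : a ∈ s ∪ t
    · rw [insert_eq_of_mem h, ← Finset.mul_prod_erase _ _ h, ← mul_assoc, hg]
    · rw [prod_insert h]

theorem prod_idem_biUnion {κ τ : Type*} [DecidableEq κ] [DecidableEq τ] (g : κ → ℝ)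
    (hg : ∀ e, g e * g e = g e) (b : Finset τ) (s : τ → Finset κ) :
    ∏ i ∈ b, ∏ e ∈ s i, g e = ∏ e ∈ b.biUnion s, g e := by
  induction b using Finset.induction_on with
  | empty => simp
  | insert a b ha ih => rw [prod_insert ha, ih, prod_idem_union g hg, biUnion_insert]

/-- Products over a set of non-loop edges as products over ordered pairs. -/
theorem prod_sym2_eq_prod_lt {n : ℕ} (U : Finset (Sym2 (Fin n))) (hU : ∀ e ∈ U, ¬ e.IsDiag)
    (g : Sym2 (Fin n) → ℝ) :
    ∏ e ∈ U, g e = ∏ q : {q : Fin n × Fin n // q.1 < q.2},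
      if s(q.1.1, q.1.2) ∈ U then g s(q.1.1, q.1.2) else 1 := by
  rw [← Finset.prod_filter]
  symm
  refine Finset.prod_bij (fun q _ => s(q.1.1, q.1.2)) ?_ ?_ ?_ ?_
  · intro q hq; exact (mem_filter.1 hq).2
  · rintro ⟨⟨a, b⟩, hab⟩ _ ⟨⟨c, d⟩, hcd⟩ _ h
    simp only [Sym2.eq_iff] at h
    rcases h with ⟨rfl, rfl⟩ | ⟨rfl, rfl⟩
    · rfl
    · exact absurd hab (not_lt.2 hcd.le)
  · intro e he
    induction e using Sym2.ind with
    | _ a b =>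
      have hab : a ≠ b := fun h => hU _ he (by simpa using h)
      rcases lt_or_gt_of_ne hab with h | h
      · exact ⟨⟨(a, b), h⟩, by simpa using he, rfl⟩
      · exact ⟨⟨(b, a), h⟩, by simpa [Sym2.eq_swap] using he, Sym2.eq_swap⟩
  · intro q _; rfl

end Edges

section Model

/-- The binomial random-connection model on `n` vertices. -/
structure IsRCM {n : ℕ} {E Ω : Type*} [MeasurableSpace E] [MeasurableSpace Ω] (μ : Measure E)
    (H : E → E → ℝ) (p : ℝ) (P : Measure Ω) (X : Fin n → Ω → E)
    (Y : Fin n → Fin n → Ω → ℝ) : Prop where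
  measurable : Measurable fun z : E × E => H z.1 z.2
  symm : ∀ x y, H x y = H y x
  mem_Icc : ∀ x y, H x y ∈ Set.Icc (0 : ℝ) 1
  p_mem : p ∈ Set.Ioo (0 : ℝ) 1
  Y_symm : ∀ a b, Y a b = Y b a
  law : Measure.map (fun ω => ((fun i => X i ω),
        (fun q : {q : Fin n × Fin n // q.1 < q.2} => Y q.1.1 q.1.2 ω))) P
      = (Measure.pi fun _ => μ).prod
          (Measure.pi fun _ => (volume.restrict (Set.Icc (0 : ℝ) 1)))

variable {n : ℕ} {E Ω : Type*} [MeasurableSpace E] [MeasurableSpace Ω] {μ : Measure E}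
  {H : E → E → ℝ} {p : ℝ} {P : Measure Ω} {X : Fin n → Ω → E} {Y : Fin n → Fin n → Ω → ℝ}

instance isProbabilityMeasure_restrict_Icc :
    IsProbabilityMeasure (volume.restrict (Set.Icc (0 : ℝ) 1)) := ⟨by simp⟩

theorem integral_ite_le {c : ℝ} (hc : c ∈ Set.Icc (0 : ℝ) 1) :
    ∫ y, (if y ≤ c then (1 : ℝ) else 0) ∂(volume.restrict (Set.Icc (0 : ℝ) 1)) = c := by
  have : (fun y : ℝ => if y ≤ c then (1 : ℝ) else 0) = (Set.Iic c).indicator 1 := by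
    funext y; simp [Set.indicator_apply]
  rw [this, integral_indicator_one measurableSet_Iic, measureReal_restrict_apply measurableSet_Iic]
  have h2 : Set.Iic c ∩ Set.Icc 0 1 = Set.Icc 0 c := by
    ext y
    simp only [Set.mem_inter_iff, Set.mem_Iic, Set.mem_Icc]
    exact ⟨fun h => ⟨h.2.1, h.1⟩, fun h => ⟨h.2, h.1, h.2.trans hc.2⟩⟩
  rw [h2]
  simp [hc.1]

theorem measurable_edgeWeight {V : Type*} (hHm : Measurable fun z : E × E => H z.1 z.2)
    (e : Sym2 V) : Measurable (edgeWeight H e : (V → E) → ℝ) :=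
  hHm.comp (f := fun x : V → E => (x (Quot.out e : V × V).1, x (Quot.out e : V × V).2))
    ((measurable_pi_apply _).prodMk (measurable_pi_apply _))

namespace IsRCM

variable [IsProbabilityMeasure μ]

theorem aemeasurable_coords (h : IsRCM μ H p P X Y) : AEMeasurable (fun ω => ((fun i => X i ω),
    (fun q : {q : Fin n × Fin n // q.1 < q.2} => Y q.1.1 q.1.2 ω))) P := by
  by_contra hc
  have h1 := h.law
  rw [Measure.map_of_not_aemeasurable hc] at h1
  exact (IsProbabilityMeasure.ne_zero _) h1.symm

theorem aemeasurable_X (h : IsRCM μ H p P X Y) : AEMeasurable (fun ω i => X i ω) P :=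
  measurable_fst.comp_aemeasurable h.aemeasurable_coords

theorem aestronglyMeasurable_edgeInd (h : IsRCM μ H p P X Y) {e : Sym2 (Fin n)}
    (he : ¬ e.IsDiag) :
    AEStronglyMeasurable (edgeInd H p X Y e) P := by
  have key : ∀ a b : Fin n, a < b → AEStronglyMeasurable (edgeInd H p X Y s(a, b)) P := by
    intro a b hab
    have h1 : edgeInd H p X Y s(a, b) = fun ω =>
        if Y a b ω ≤ p * H (X a ω) (X b ω) then (1 : ℝ) else 0 := by
      funext ω; exact edgeInd_mk h.symm p X h.Y_symm a b ω
    rw [h1]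
    have h2 : Measurable fun w : (Fin n → E) × ({q : Fin n × Fin n // q.1 < q.2} → ℝ) =>
        if w.2 ⟨(a, b), hab⟩ ≤ p * H (w.1 a) (w.1 b) then (1 : ℝ) else 0 := by
      refine Measurable.ite (measurableSet_le ?_ ?_) measurable_const measurable_const
      · fun_prop
      · exact (h.measurable.comp (f := fun w : (Fin n → E) × _ => (w.1 a, w.1 b))
          (by fun_prop)).const_mul p
    exact (h2.comp_aemeasurable h.aemeasurable_coords).aestronglyMeasurable
  induction e using Sym2.ind with
  | _ a b =>
    have hab : a ≠ b := fun hh => he (by simpa using hh)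
    rcases lt_or_gt_of_ne hab with hl | hl
    · exact key a b hl
    · rw [Sym2.eq_swap]; exact key b a hl

/-- Integrating out the edge variables. -/
theorem integral_prod_edgeInd_mul (h : IsRCM μ H p P X Y) (U : Finset (Sym2 (Fin n)))
    (hU : ∀ e ∈ U, ¬ e.IsDiag)
    {φ : (Fin n → E) → ℝ} (hφ : Measurable φ) {B : ℝ} (hB : ∀ x, |φ x| ≤ B) :
    ∫ ω, (∏ e ∈ U, edgeInd H p X Y e ω) * φ (fun i => X i ω) ∂P =
      p ^ U.card * ∫ x, (∏ e ∈ U, edgeWeight H e x) * φ x ∂(Measure.pi fun _ => μ) := by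
  let Q := {q : Fin n × Fin n // q.1 < q.2}
  let F : Q → (Fin n → E) → ℝ → ℝ := fun q x y =>
    if s(q.1.1, q.1.2) ∈ U then (if y ≤ p * H (x q.1.1) (x q.1.2) then 1 else 0) else 1
  let Ψ : (Fin n → E) × (Q → ℝ) → ℝ := fun w => (∏ q : Q, F q w.1 (w.2 q)) * φ w.1
  have hF01 : ∀ q x y, |F q x y| ≤ 1 := by
    intro q x y; simp only [F]; split_ifs <;> simp
  have hFm : ∀ q : Q, Measurable fun w : (Fin n → E) × (Q → ℝ) => F q w.1 (w.2 q) := by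
    intro q
    simp only [F]
    split_ifs
    · refine Measurable.ite (measurableSet_le (by fun_prop) ?_) measurable_const measurable_const
      exact (h.measurable.comp (f := fun w : (Fin n → E) × _ => (w.1 q.1.1, w.1 q.1.2))
        (by fun_prop)).const_mul p
    · exact measurable_const
  have hΨm : Measurable Ψ :=
    (Finset.measurable_prod _ fun q _ => hFm q).mul (hφ.comp measurable_fst)
  have hΨb : ∀ w, ‖Ψ w‖ ≤ B := by
    intro w
    simp only [Ψ, norm_mul, Real.norm_eq_abs, Finset.abs_prod]
    calc (∏ q, |F q w.1 (w.2 q)|) * |φ w.1| ≤ 1 * B := by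
          refine mul_le_mul ?_ (hB _) (abs_nonneg _) zero_le_one
          exact Finset.prod_le_one (fun _ _ => abs_nonneg _) fun _ _ => hF01 _ _ _
      _ = B := one_mul B
  have h1 : ∀ ω, (∏ e ∈ U, edgeInd H p X Y e ω) * φ (fun i => X i ω) =
      Ψ ((fun i => X i ω), (fun q : Q => Y q.1.1 q.1.2 ω)) := by
    intro ω
    simp only [Ψ, F]
    rw [prod_sym2_eq_prod_lt U hU]
    simp only [edgeInd_mk h.symm p X h.Y_symm]
    rfl
  simp_rw [h1]
  rw [← integral_map h.aemeasurable_coords hΨm.aestronglyMeasurable, h.law,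
    integral_prod _ (Integrable.of_bound hΨm.aestronglyMeasurable B (ae_of_all _ hΨb)),
    ← integral_const_mul]
  congr 1
  funext x
  simp only [Ψ]
  rw [integral_mul_const, integral_fintype_prod_eq_prod (fun q => F q x), ← mul_assoc]
  congr 1
  have h2 : ∀ q : Q, ∫ y, F q x y ∂(volume.restrict (Set.Icc (0 : ℝ) 1)) =
      if s(q.1.1, q.1.2) ∈ U then p * edgeWeight H s(q.1.1, q.1.2) x else 1 := by
    intro q
    simp only [F]
    split_ifs with hq
    · rw [integral_ite_le, edgeWeight_mk h.symm]
      have := h.mem_Icc (x q.1.1) (x q.1.2)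
      exact ⟨mul_nonneg h.p_mem.1.le this.1, mul_le_one₀ h.p_mem.2.le this.1 this.2⟩
    · simp
  rw [Finset.prod_congr rfl fun q _ => h2 q,
    ← prod_sym2_eq_prod_lt U hU (fun e => p * edgeWeight H e x), Finset.prod_mul_distrib,
    Finset.prod_const]

end IsRCM

end Model

section Balanced

variable {k n : ℕ} (G : SimpleGraph (Fin k)) [DecidableRel G.Adj]

/-- The edges of the copy of `G` placed at `β`. -/
def copyEdges (β : Fin k → Fin n) : Finset (Sym2 (Fin n)) := G.edgeFinset.image (Sym2.map β)

/-- The vertices of the copy of `G` placed at `β`. -/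
def copyVerts (β : Fin k → Fin n) : Finset (Fin n) := univ.image β

variable {G}

theorem not_isDiag_of_mem_copyEdges {β : Fin k → Fin n} (hβ : Function.Injective β)
    {e : Sym2 (Fin n)} (he : e ∈ copyEdges G β) : ¬ e.IsDiag := by
  obtain ⟨f, hf, rfl⟩ := mem_image.1 he
  induction f using Sym2.ind with
  | _ a b =>
    have : G.Adj a b := by simpa using hf
    simpa using fun hab => this.ne (hβ hab)

theorem mem_copyVerts_of_mem_copyEdges {β : Fin k → Fin n}
    {e : Sym2 (Fin n)} (he : e ∈ copyEdges G β) {v : Fin n} (hv : v ∈ e) : v ∈ copyVerts β := by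
  obtain ⟨f, hf, rfl⟩ := mem_image.1 he
  obtain ⟨a, -, rfl⟩ := Sym2.mem_map.1 hv
  exact mem_image_of_mem _ (mem_univ _)

theorem card_copyEdges {β : Fin k → Fin n} (hβ : Function.Injective β) :
    (copyEdges G β).card = G.edgeFinset.card :=
  Finset.card_image_of_injective _ (Sym2.map.injective hβ)

theorem card_copyVerts {β : Fin k → Fin n} (hβ : Function.Injective β) :
    (copyVerts β).card = k := by
  rw [copyVerts, Finset.card_image_of_injective _ hβ, card_univ, Fintype.card_fin]

/-- The part of a copy of a strongly balanced graph overlapping a given graph is sparse. -/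
theorem StronglyBalanced.card_inter_mul_le (hbal : StronglyBalanced G) {β : Fin k → Fin n}
    (hβ : Function.Injective β) {V : Finset (Fin n)} {U : Finset (Sym2 (Fin n))}
    (hUV : ∀ e ∈ U, ∀ v ∈ e, v ∈ V) :
    (copyEdges G β ∩ U).card * (k - 1) ≤ G.edgeFinset.card * ((copyVerts β ∩ V).card - 1) := by
  let Hs : G.Subgraph :=
    { verts := {a | β a ∈ V}
      Adj := fun a b => G.Adj a b ∧ s(β a, β b) ∈ U
      adj_sub := fun h => h.1
      edge_vert := fun {a b} h => hUV _ h.2 _ (Sym2.mem_mk_left _ _)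
      symm := ⟨fun a b h => ⟨h.1.symm, by rw [Sym2.eq_swap]; exact h.2⟩⟩ }
  have hv : Hs.verts.ncard = (copyVerts β ∩ V).card := by
    have : copyVerts β ∩ V = (univ.filter fun a => β a ∈ V).image β := by
      ext v
      simp only [copyVerts, mem_inter, mem_image, mem_univ, true_and, mem_filter]
      exact ⟨fun ⟨⟨a, ha⟩, hv⟩ => ⟨a, ha ▸ hv, ha⟩, fun ⟨a, h1, h2⟩ => ⟨⟨a, h2⟩, h2 ▸ h1⟩⟩
    rw [this, card_image_of_injective _ hβ, ← Set.ncard_coe_finset]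
    congr 1
    ext a; simp [Hs]
  have he : Hs.edgeSet.ncard = (copyEdges G β ∩ U).card := by
    have : copyEdges G β ∩ U =
        (G.edgeFinset.filter fun e => Sym2.map β e ∈ U).image (Sym2.map β) := by
      ext v
      simp only [copyEdges, mem_inter, mem_image, mem_filter]
      exact ⟨fun ⟨⟨a, h1, ha⟩, hv⟩ => ⟨a, ⟨h1, ha ▸ hv⟩, ha⟩,
        fun ⟨a, ⟨h0, h1⟩, h2⟩ => ⟨⟨a, h0, h2⟩, h2 ▸ h1⟩⟩
    rw [this, card_image_of_injective _ (Sym2.map.injective hβ), ← Set.ncard_coe_finset]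
    congr 1
    ext e
    induction e using Sym2.ind with
    | _ a b => simp [Hs]
  rw [← hv, ← he]
  by_cases h2 : 2 ≤ Hs.verts.ncard
  · exact hbal Hs h2
  · have h0 : Hs.edgeSet.ncard = 0 := by
      rw [Set.ncard_eq_zero]
      refine Set.eq_empty_iff_forall_notMem.2 fun e he => h2 ?_
      induction e using Sym2.ind with
      | _ a b =>
        have hab : Hs.Adj a b := he
        have : ({a, b} : Set (Fin k)) ⊆ Hs.verts := by
          rintro x (rfl | rfl)
          · exact hab.fst_mem
          · exact hab.snd_mem
        calc 2 = ({a, b} : Set (Fin k)).ncard := (Set.ncard_pair hab.ne).symm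
          _ ≤ _ := Set.ncard_le_ncard this (Set.toFinite _)
    rw [h0, zero_mul]
    exact Nat.zero_le _

/-- The growth factor attached to adding one overlapping copy of a graph. -/
noncomputable def growth (k e : ℕ) (x p : ℝ) : ℝ := max 1 (x ^ (k - 1) * p ^ e)

theorem one_le_growth (k e : ℕ) (x p : ℝ) : 1 ≤ growth k e x p := le_max_left _ _

theorem pow_mul_pow_le_growth {k e v e' : ℕ} {x p : ℝ} (hk : 2 ≤ k) (hx : 0 ≤ x)
    (hp0 : 0 ≤ p) (hp1 : p ≤ 1) (hv : 1 ≤ v) (hvk : v ≤ k)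
    (h : e' * (k - 1) ≤ e * (v - 1)) :
    x ^ (k - v) * p ^ (e - e') ≤ growth k e x p := by
  have h1 : (x ^ (k - v) * p ^ (e - e')) ^ (k - 1) ≤ growth k e x p ^ (k - 1) := by
    have hexp : e * (k - v) ≤ (e - e') * (k - 1) := by
      have hkv : k - v = (k - 1) - (v - 1) := by omega
      rw [hkv, Nat.mul_sub, Nat.sub_mul]
      exact Nat.sub_le_sub_left h _
    calc (x ^ (k - v) * p ^ (e - e')) ^ (k - 1)
        = x ^ ((k - 1) * (k - v)) * p ^ ((e - e') * (k - 1)) := by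
          rw [mul_pow, ← pow_mul, ← pow_mul, mul_comm (k - v)]
      _ ≤ x ^ ((k - 1) * (k - v)) * p ^ (e * (k - v)) := by
          exact mul_le_mul_of_nonneg_left (pow_le_pow_of_le_one hp0 hp1 hexp) (by positivity)
      _ = (x ^ (k - 1) * p ^ e) ^ (k - v) := by rw [mul_pow, ← pow_mul, ← pow_mul]
      _ ≤ growth k e x p ^ (k - v) :=
          pow_le_pow_left₀ (by positivity) (le_max_right _ _) _
      _ ≤ growth k e x p ^ (k - 1) :=
          pow_le_pow_right₀ (one_le_growth _ _ _ _) (by omega)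
  exact le_of_pow_le_pow_left₀ (by omega) (zero_le_one.trans (one_le_growth _ _ _ _)) h1

/-- Adding one overlapping copy costs at most a factor `growth`. -/
theorem StronglyBalanced.pow_card_union_le (hbal : StronglyBalanced G) (hk : 2 ≤ k)
    {p : ℝ} (hp0 : 0 ≤ p) (hp1 : p ≤ 1) {β : Fin k → Fin n}
    (hβ : Function.Injective β) {V : Finset (Fin n)} {U : Finset (Sym2 (Fin n))}
    (hUV : ∀ e ∈ U, ∀ v ∈ e, v ∈ V) (hne : (copyVerts β ∩ V).Nonempty) :
    (n : ℝ) ^ (copyVerts β ∪ V).card * p ^ (copyEdges G β ∪ U).card ≤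
      (n : ℝ) ^ V.card * p ^ U.card * growth k G.edgeFinset.card n p := by
  have hv := Finset.card_union_add_card_inter (copyVerts β) V
  have he := Finset.card_union_add_card_inter (copyEdges G β) U
  have hv' : (copyVerts β ∩ V).card ≤ k :=
    (card_le_card inter_subset_left).trans (card_copyVerts hβ).le
  have he' : (copyEdges G β ∩ U).card ≤ G.edgeFinset.card :=
    (card_le_card inter_subset_left).trans (card_copyEdges hβ).le
  rw [card_copyVerts hβ] at hv
  rw [card_copyEdges hβ] at he
  have h1 : (copyVerts β ∪ V).card = V.card + (k - (copyVerts β ∩ V).card) := by omega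
  have h2 : (copyEdges G β ∪ U).card =
    U.card + (G.edgeFinset.card - (copyEdges G β ∩ U).card) := by omega
  rw [h1, h2, pow_add, pow_add]
  calc _ = (n : ℝ) ^ V.card * p ^ U.card * ((n : ℝ) ^ (k - (copyVerts β ∩ V).card) *
        p ^ (G.edgeFinset.card - (copyEdges G β ∩ U).card)) := by ring
    _ ≤ _ := mul_le_mul_of_nonneg_left (pow_mul_pow_le_growth hk (Nat.cast_nonneg _) hp0 hp1
        (Finset.card_pos.2 hne) hv' (hbal.card_inter_mul_le hβ hUV)) (by positivity)

/-- A family of vertex sets is linked if it cannot be split into two groups without common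
vertices. -/
def Linked {j : ℕ} (W : Fin j → Finset (Fin n)) : Prop :=
  ∀ A : Finset (Fin j), A.Nonempty → A ≠ univ → ∃ i ∈ A, ∃ i' ∉ A, ¬ Disjoint (W i) (W i')

theorem StronglyBalanced.pow_card_biUnion_le (hbal : StronglyBalanced G) (hk : 2 ≤ k)
    {p : ℝ} (hp0 : 0 ≤ p) (hp1 : p ≤ 1) {j : ℕ} (hj : 1 ≤ j) {β : Fin j → Fin k → Fin n}
    (hβ : ∀ i, Function.Injective (β i)) (hlink : Linked fun i => copyVerts (β i)) :
    (n : ℝ) ^ (univ.biUnion fun i => copyVerts (β i)).card *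
        p ^ (univ.biUnion fun i => copyEdges G (β i)).card ≤
      (n : ℝ) ^ k * p ^ G.edgeFinset.card * growth k G.edgeFinset.card n p ^ (j - 1) := by
  have key : ∀ t, 1 ≤ t → t ≤ j → ∃ S : Finset (Fin j), S.card = t ∧
      (n : ℝ) ^ (S.biUnion fun i => copyVerts (β i)).card *
        p ^ (S.biUnion fun i => copyEdges G (β i)).card ≤
      (n : ℝ) ^ k * p ^ G.edgeFinset.card * growth k G.edgeFinset.card n p ^ (t - 1) := by
    intro t ht
    induction t, ht using Nat.le_induction with
    | base =>
      intro _
      refine ⟨{⟨0, hj⟩}, card_singleton _, ?_⟩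
      rw [singleton_biUnion, singleton_biUnion, card_copyVerts (hβ _), card_copyEdges (hβ _)]
      simp
    | succ t ht ih =>
      intro htj
      obtain ⟨S, hS, hle⟩ := ih (by omega)
      obtain ⟨i, hi, i', hi', hd⟩ := hlink S (Finset.card_pos.1 (by omega)) (by
        rintro rfl
        rw [card_univ, Fintype.card_fin] at hS
        omega)
      refine ⟨insert i' S, by rw [card_insert_of_notMem hi', hS], ?_⟩
      rw [biUnion_insert, biUnion_insert]
      refine (hbal.pow_card_union_le hk hp0 hp1 (hβ i') ?_ ?_).trans ?_
      · intro e he v hv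
        obtain ⟨a, ha, hea⟩ := mem_biUnion.1 he
        exact mem_biUnion.2 ⟨a, ha, mem_copyVerts_of_mem_copyEdges hea hv⟩
      · obtain ⟨v, hv, hv'⟩ := Finset.not_disjoint_iff.1 hd
        exact ⟨v, mem_inter.2 ⟨hv', mem_biUnion.2 ⟨i, hi, hv⟩⟩⟩
      · have ht1 : t + 1 - 1 = (t - 1) + 1 := by omega
        rw [ht1, pow_succ, ← mul_assoc]
        exact mul_le_mul_of_nonneg_right hle (zero_le_one.trans (one_le_growth _ _ _ _))
  obtain ⟨S, hS, hle⟩ := key j hj le_rfl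
  have : S = univ := by
    rw [← Finset.card_eq_iff_eq_univ, hS, Fintype.card_fin]
  rwa [this] at hle

end Balanced

section Moments

variable {n : ℕ} {E Ω : Type*} [MeasurableSpace E] [MeasurableSpace Ω] {μ : Measure E}
  {H : E → E → ℝ} {p : ℝ} {P : Measure Ω} {X : Fin n → Ω → E} {Y : Fin n → Fin n → Ω → ℝ}

/-- The probability that all edges of `U` are present. -/
noncomputable def edgeMoment (μ : Measure E) (H : E → E → ℝ) (p : ℝ)
    (U : Finset (Sym2 (Fin n))) : ℝ :=
  p ^ U.card * ∫ x, ∏ e ∈ U, edgeWeight H e x ∂(Measure.pi fun _ => μ)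

theorem integral_mem_Icc_zero_one {S : Type*} [MeasurableSpace S] {ν : Measure S}
    [IsProbabilityMeasure ν] {f : S → ℝ} (hf : ∀ x, f x ∈ Set.Icc (0 : ℝ) 1) :
    ∫ x, f x ∂ν ∈ Set.Icc (0 : ℝ) 1 := by
  refine ⟨integral_nonneg fun x => (hf x).1, ?_⟩
  calc ∫ x, f x ∂ν ≤ ∫ _, (1 : ℝ) ∂ν :=
        integral_mono_of_nonneg (ae_of_all _ fun x => (hf x).1) (integrable_const _)
          (ae_of_all _ fun x => (hf x).2)
    _ = 1 := by simp

variable [IsProbabilityMeasure μ]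

theorem edgeMoment_mem_Icc (hH : ∀ x y, H x y ∈ Set.Icc (0 : ℝ) 1) (hp : p ∈ Set.Ioo (0 : ℝ) 1)
    (U : Finset (Sym2 (Fin n))) : edgeMoment μ H p U ∈ Set.Icc (0 : ℝ) (p ^ U.card) := by
  have h := integral_mem_Icc_zero_one (ν := Measure.pi fun _ : Fin n => μ)
    (prod_edgeWeight_mem_Icc hH U)
  have hp' := pow_nonneg hp.1.le U.card
  exact ⟨mul_nonneg hp' h.1, mul_le_of_le_one_right hp' h.2⟩

theorem edgeMoment_empty : edgeMoment μ H p (∅ : Finset (Sym2 (Fin n))) = 1 := by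
  simp [edgeMoment]

theorem edgeMoment_union {U U' : Finset (Sym2 (Fin n))} {S T : Set (Fin n)}
    (hU : ∀ e ∈ U, ∀ v ∈ e, v ∈ S) (hU' : ∀ e ∈ U', ∀ v ∈ e, v ∈ T) (hST : Disjoint S T) :
    edgeMoment μ H p (U ∪ U') = edgeMoment μ H p U * edgeMoment μ H p U' := by
  have hd : Disjoint U U' := by
    refine Finset.disjoint_left.2 fun e he he' => ?_
    induction e using Sym2.ind with
    | _ a b =>
      exact Set.disjoint_left.1 hST (hU _ he a (Sym2.mem_mk_left _ _))
        (hU' _ he' a (Sym2.mem_mk_left _ _))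
  unfold edgeMoment
  rw [card_union_of_disjoint hd]
  simp_rw [Finset.prod_union hd]
  rw [integral_mul_of_dependsOn μ (dependsOn_prod_edgeWeight H hU) (dependsOn_prod_edgeWeight H hU')
    hST]
  ring

theorem IsRCM.integral_prod_edgeInd (h : IsRCM μ H p P X Y) (U : Finset (Sym2 (Fin n)))
    (hU : ∀ e ∈ U, ¬ e.IsDiag) : ∫ ω, ∏ e ∈ U, edgeInd H p X Y e ω ∂P = edgeMoment μ H p U := by
  have := h.integral_prod_edgeInd_mul U hU (φ := fun _ => 1) measurable_const (B := 1)
    (fun _ => by simp)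
  simpa [edgeMoment] using this

variable {j : ℕ}

theorem setCumulant_edgeMoment_eq_zero (U : Fin j → Finset (Sym2 (Fin n)))
    (W : Fin j → Finset (Fin n)) (hUW : ∀ i, ∀ e ∈ U i, ∀ v ∈ e, v ∈ W i) (hW : ¬ Linked W) :
    setCumulant (fun b => edgeMoment μ H p (b.biUnion U)) = 0 := by
  unfold Linked at hW
  push Not at hW
  obtain ⟨A, hA, hA', hd⟩ := hW
  refine setCumulant_eq_zero_of_split _ (by simpa using edgeMoment_empty) A hA hA' fun b => ?_
  have hb : b.biUnion U = (b ∩ A).biUnion U ∪ (b \ A).biUnion U := by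
    rw [← union_biUnion, Finset.union_comm, Finset.sdiff_union_inter]
  rw [hb]
  refine edgeMoment_union (S := A.biUnion W) (T := Aᶜ.biUnion W) ?_ ?_ ?_
  · intro e he v hv
    obtain ⟨i, hi, hei⟩ := mem_biUnion.1 he
    exact mem_biUnion.2 ⟨i, (mem_inter.1 hi).2, hUW i e hei v hv⟩
  · intro e he v hv
    obtain ⟨i, hi, hei⟩ := mem_biUnion.1 he
    exact mem_biUnion.2 ⟨i, mem_compl.2 (mem_sdiff.1 hi).2, hUW i e hei v hv⟩
  · rw [Finset.disjoint_coe, Finset.disjoint_biUnion_left]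
    intro i hi
    rw [Finset.disjoint_biUnion_right]
    intro i' hi'
    exact hd i hi i' (mem_compl.1 hi')

theorem abs_setCumulant_edgeMoment_le (hH : ∀ x y, H x y ∈ Set.Icc (0 : ℝ) 1)
    (hp : p ∈ Set.Ioo (0 : ℝ) 1) (U : Fin j → Finset (Sym2 (Fin n))) :
    |setCumulant (fun b => edgeMoment μ H p (b.biUnion U))| ≤
      (j : ℝ) ^ j * p ^ (univ.biUnion U).card := by
  have := abs_setCumulant_le (fun b => edgeMoment μ H p (b.biUnion U))
    (p ^ (univ.biUnion U).card) ?_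
  · simpa using this
  intro σ
  have h0 : ∀ b, 0 ≤ edgeMoment μ H p (Finset.biUnion b U) := fun b =>
    (edgeMoment_mem_Icc hH hp _).1
  rw [abs_of_nonneg (Finset.prod_nonneg fun b _ => h0 b)]
  calc ∏ b ∈ σ.parts, edgeMoment μ H p (b.biUnion U)
      ≤ ∏ b ∈ σ.parts, p ^ (b.biUnion U).card :=
        Finset.prod_le_prod (fun b _ => h0 b) fun b _ => (edgeMoment_mem_Icc hH hp _).2
    _ = p ^ (∑ b ∈ σ.parts, (b.biUnion U).card) := Finset.prod_pow_eq_pow_sum _ _ _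
    _ ≤ p ^ (univ.biUnion U).card := by
        refine pow_le_pow_of_le_one hp.1.le hp.2.le ?_
        have : univ.biUnion U = σ.parts.biUnion fun b => b.biUnion U := by
          conv_lhs => rw [← σ.biUnion_parts]
          rw [Finset.biUnion_biUnion]
          rfl
        rw [this]
        exact Finset.card_biUnion_le

end Moments

section Counts

variable {k n : ℕ} {G : SimpleGraph (Fin k)} [DecidableRel G.Adj]

theorem prod_filter_adj (G : SimpleGraph (Fin k)) [DecidableRel G.Adj] (g : Sym2 (Fin k) → ℝ) :
    ∏ q ∈ (univ : Finset (Fin k × Fin k)).filter (fun q => q.1 < q.2 ∧ G.Adj q.1 q.2),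
      g s(q.1, q.2) = ∏ e ∈ G.edgeFinset, g e := by
  rw [prod_sym2_eq_prod_lt G.edgeFinset (fun e he => G.not_isDiag_of_mem_edgeFinset he) g,
    ← Finset.prod_filter]
  refine Finset.prod_bij' (fun q hq => ⟨q, (mem_filter.1 hq).2.1⟩) (fun q _ => q.1) ?_ ?_ ?_ ?_ ?_
  · intro q hq
    simpa using (mem_filter.1 hq).2.2
  · intro q hq
    exact mem_filter.2 ⟨mem_univ _, q.2, by simpa using (mem_filter.1 hq).2⟩
  · intros; rfl
  · intros; rfl
  · intros; rfl

theorem prod_copyEdges {β : Fin k → Fin n} (hβ : Function.Injective β)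
    (g : Sym2 (Fin n) → ℝ) :
    ∏ e ∈ copyEdges G β, g e = ∏ e ∈ G.edgeFinset, g (Sym2.map β e) :=
  Finset.prod_image fun _ _ _ _ h => Sym2.map.injective hβ h

variable {d : ℕ} {Ω : Type*} [MeasurableSpace Ω] {μ : Measure (Fin d → ℝ)}
  {H : (Fin d → ℝ) → (Fin d → ℝ) → ℝ} {p : ℝ} {P : Measure Ω} {X : Fin n → Ω → Fin d → ℝ}
  {Y : Fin n → Fin n → Ω → ℝ}

theorem IsRCM.NG_eq (h : IsRCM μ H p P X Y) (a : ℕ) (ω : Ω) :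
    NG G H p a X Y ω = (a : ℝ)⁻¹ * ∑ β : {β : Fin k → Fin n // Function.Injective β},
      ∏ e ∈ copyEdges G β.1, edgeInd H p X Y e ω := by
  unfold NG
  congr 1
  rw [Finset.sum_subtype (p := Function.Injective) _ (by simp)]
  refine Finset.sum_congr rfl fun β _ => ?_
  rw [prod_copyEdges β.2, ← prod_filter_adj G fun e => edgeInd H p X Y (Sym2.map β.1 e) ω]
  refine Finset.prod_congr rfl fun q _ => ?_
  rw [Sym2.map_mk, edgeInd_mk h.symm p X h.Y_symm]

theorem sum_inv_pow_card_biUnion_le (j : ℕ) :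
    ∑ g : Fin j → {β : Fin k → Fin n // Function.Injective β},
      ((n : ℝ)⁻¹) ^ (univ.biUnion fun i => copyVerts (g i).1).card ≤
        ((j * k : ℕ) : ℝ) ^ (j * k) := by
  let Φ : (Fin j → {β : Fin k → Fin n // Function.Injective β}) ↪ (Fin j × Fin k → Fin n) :=
    ⟨fun g q => (g q.1).1 q.2, fun g g' h => by
      funext i
      refine Subtype.ext (funext fun a => ?_)
      exact congrFun h (i, a)⟩
  have h1 : ∀ g, (univ.biUnion fun i => copyVerts (g i).1) = univ.image (Φ g) := by
    intro g
    ext v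
    simp only [copyVerts, mem_biUnion, mem_image, mem_univ, true_and, Prod.exists]
    rfl
  simp_rw [h1]
  have h2 := sum_inv_pow_card_image_le (α := Fin j × Fin k) n
  rw [Fintype.card_prod, Fintype.card_fin, Fintype.card_fin] at h2
  refine le_trans ?_ h2
  rw [← Finset.sum_map univ Φ fun c : Fin j × Fin k → Fin n => ((n : ℝ)⁻¹) ^ (univ.image c).card]
  exact Finset.sum_le_sum_of_subset_of_nonneg (subset_univ _) fun _ _ _ => by positivity

variable [IsProbabilityMeasure μ] [IsProbabilityMeasure P]

theorem IsRCM.integrable_prod_edgeInd (h : IsRCM μ H p P X Y) {U : Finset (Sym2 (Fin n))}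
    (hU : ∀ e ∈ U, ¬ e.IsDiag) : Integrable (fun ω => ∏ e ∈ U, edgeInd H p X Y e ω) P := by
  refine Integrable.of_bound (C := 1) ?_ (ae_of_all _ fun ω => ?_)
  · exact Finset.aestronglyMeasurable_fun_prod U fun e he => h.aestronglyMeasurable_edgeInd (hU e he)
  · rw [Real.norm_eq_abs, abs_of_nonneg (Finset.prod_nonneg fun e _ => edgeInd_nonneg H p X Y e ω)]
    exact Finset.prod_le_one (fun e _ => edgeInd_nonneg H p X Y e ω)
      fun e _ => edgeInd_le_one H p X Y e ω

/-- The cumulant of a weighted sum of products of edge indicators. -/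
theorem IsRCM.cum_sum_prod_edgeInd (h : IsRCM μ H p P X Y) {τ : Type*} [Fintype τ] [DecidableEq τ]
    (c : τ → ℝ) (U : τ → Finset (Sym2 (Fin n))) (hU : ∀ o, ∀ e ∈ U o, ¬ e.IsDiag) (j : ℕ) :
    cum P j (fun ω => ∑ o, c o * ∏ e ∈ U o, edgeInd H p X Y e ω) =
      ∑ f : Fin j → τ, (∏ i, c (f i)) *
        setCumulant (fun b => edgeMoment μ H p (b.biUnion fun i => U (f i))) := by
  have h1 : ∀ (f : Fin j → τ) (b : Finset (Fin j)) (ω : Ω),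
      ∏ i ∈ b, (c (f i) * ∏ e ∈ U (f i), edgeInd H p X Y e ω) =
        (∏ i ∈ b, c (f i)) * ∏ e ∈ b.biUnion (fun i => U (f i)), edgeInd H p X Y e ω := by
    intro f b ω
    rw [Finset.prod_mul_distrib, prod_idem_biUnion _ (fun e => edgeInd_mul_self H p X Y e ω)]
  have h2 : ∀ (f : Fin j → τ) (b : Finset (Fin j)), ∀ e ∈ b.biUnion (fun i => U (f i)),
      ¬ e.IsDiag := by
    intro f b e he
    obtain ⟨i, -, hi⟩ := mem_biUnion.1 he
    exact hU _ e hi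
  rw [cum_sum P j (fun o ω => c o * ∏ e ∈ U o, edgeInd H p X Y e ω)]
  · refine Finset.sum_congr rfl fun f _ => ?_
    rw [← setCumulant_smul]
    congr 1
    funext b
    simp_rw [h1]
    rw [integral_const_mul, h.integral_prod_edgeInd _ (h2 f b)]
  · intro f b
    simp_rw [h1]
    exact (h.integrable_prod_edgeInd (h2 f b)).const_mul _

theorem not_linked_of_eq_empty {j : ℕ} (hj : 2 ≤ j) {W : Fin j → Finset (Fin n)} {i : Fin j}
    (hi : W i = ∅) : ¬ Linked W := by
  intro hl
  obtain ⟨a, ha, a', -, hd⟩ := hl {i} (singleton_nonempty i) (by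
    intro h
    have := congrArg Finset.card h
    rw [card_singleton, card_univ, Fintype.card_fin] at this
    omega)
  rw [mem_singleton.1 ha, hi] at hd
  exact hd (disjoint_empty_left _)

theorem IsRCM.cum_NGbar_le (h : IsRCM μ H p P X Y) (hbal : StronglyBalanced G) (hk : 2 ≤ k)
    {j : ℕ} (hj : 2 ≤ j) (a : ℕ) :
    cum P j (NGbar P G H p a X Y) ≤
      ((a : ℝ)⁻¹ / √(variance (NG G H p a X Y) P)) ^ j * ((j : ℝ) ^ j *
        (((n : ℝ) ^ k * p ^ G.edgeFinset.card * growth k G.edgeFinset.card n p ^ (j - 1)) *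
          ((j * k : ℕ) : ℝ) ^ (j * k))) := by
  let B := {β : Fin k → Fin n // Function.Injective β}
  set c₀ : ℝ := (a : ℝ)⁻¹ / √(variance (NG G H p a X Y) P) with hc₀
  have hc₀' : 0 ≤ c₀ := by positivity
  let c : Option B → ℝ := fun o =>
    o.elim (-(∫ ω', NG G H p a X Y ω' ∂P) / √(variance (NG G H p a X Y) P)) fun _ => c₀
  let U : Option B → Finset (Sym2 (Fin n)) := fun o => o.elim ∅ fun β => copyEdges G β.1
  let W : Option B → Finset (Fin n) := fun o => o.elim ∅ fun β => copyVerts β.1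
  have hU : ∀ o, ∀ e ∈ U o, ¬ e.IsDiag := by
    rintro (_ | β) e he
    · simp [U] at he
    · exact not_isDiag_of_mem_copyEdges β.2 he
  have hUW : ∀ o, ∀ e ∈ U o, ∀ v ∈ e, v ∈ W o := by
    rintro (_ | β) e he v hv
    · simp [U] at he
    · exact mem_copyVerts_of_mem_copyEdges he hv
  have h1 : NGbar P G H p a X Y = fun ω => ∑ o, c o * ∏ e ∈ U o, edgeInd H p X Y e ω := by
    funext ω
    rw [Fintype.sum_option]
    simp only [c, U, Option.elim, prod_empty, mul_one]
    rw [← Finset.mul_sum, NGbar, hc₀, div_mul_eq_mul_div, ← h.NG_eq a ω]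
    ring
  rw [h1, h.cum_sum_prod_edgeInd c U hU j]
  set T : (Fin j → Option B) → ℝ := fun f => (∏ i, c (f i)) *
        setCumulant (fun b => edgeMoment μ H p (b.biUnion fun i => U (f i))) with hT
  have hT0 : ∀ f, ¬ Linked (fun i => W (f i)) → T f = 0 := by
    intro f hf
    simp only [hT]
    rw [setCumulant_edgeMoment_eq_zero (fun i => U (f i)) (fun i => W (f i))
      (fun i => hUW (f i)) hf, mul_zero]
  have h2 : ∑ f, T f = ∑ g : Fin j → B, T (fun i => some (g i)) := by
    symm
    refine Fintype.sum_of_injective (fun (g : Fin j → B) i => some (g i)) ?_ _ _ ?_ fun _ => rfl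
    · intro g g' hg
      funext i
      exact Option.some_injective _ (congrFun hg i)
    · intro f hf
      by_cases hn : ∃ i, f i = none
      · obtain ⟨i, hi⟩ := hn
        exact hT0 f (not_linked_of_eq_empty hj (i := i) (by simp [hi, W]))
      · push Not at hn
        refine absurd ⟨fun i => (f i).get (Option.isSome_iff_ne_none.2 (hn i)), ?_⟩ hf
        funext i
        simp
  rw [h2]
  set K := (n : ℝ) ^ k * p ^ G.edgeFinset.card * growth k G.edgeFinset.card n p ^ (j - 1) with hK
  have hp0 := h.p_mem.1.le
  have hK0 : 0 ≤ K := by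
    have := zero_le_one.trans (one_le_growth k G.edgeFinset.card n p)
    positivity
  have h3 : ∀ g : Fin j → B, T (fun i => some (g i)) ≤
      c₀ ^ j * ((j : ℝ) ^ j * (K * ((n : ℝ)⁻¹) ^ (univ.biUnion fun i => copyVerts (g i).1).card)) := by
    intro g
    by_cases hl : Linked (fun i => W (some (g i)))
    · have hn : 0 < (n : ℝ) := by
        have : Fin n := (g ⟨0, by omega⟩).1 ⟨0, by omega⟩
        exact_mod_cast this.pos
      have hT1 : T (fun i => some (g i)) = c₀ ^ j *
          setCumulant (fun b => edgeMoment μ H p (b.biUnion fun i => copyEdges G (g i).1)) := by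
        simp [hT, c, U]
      rw [hT1]
      refine mul_le_mul_of_nonneg_left ?_ (by positivity)
      refine (le_abs_self _).trans ((abs_setCumulant_edgeMoment_le h.mem_Icc h.p_mem _).trans ?_)
      refine mul_le_mul_of_nonneg_left ?_ (by positivity)
      rw [inv_pow, ← div_eq_mul_inv, le_div_iff₀ (by positivity), mul_comm]
      exact hbal.pow_card_biUnion_le hk hp0 h.p_mem.2.le (by omega) (fun i => (g i).2) hl
    · rw [hT0 _ hl]
      positivity
  refine (Finset.sum_le_sum fun g _ => h3 g).trans ?_
  rw [← Finset.mul_sum, ← Finset.mul_sum, ← Finset.mul_sum]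
  gcongr
  exact sum_inv_pow_card_biUnion_le j

end Counts

section GraphWeight

variable {k n : ℕ} (G : SimpleGraph (Fin k)) [DecidableRel G.Adj] {E : Type*} (H : E → E → ℝ)

/-- The product of the connection function over the edges of a graph. -/
noncomputable def graphWeight (z : Fin k → E) : ℝ := ∏ e ∈ G.edgeFinset, edgeWeight H e z

variable {G H}

theorem graphWeight_mem_Icc (hH : ∀ x y, H x y ∈ Set.Icc (0 : ℝ) 1) (z : Fin k → E) :
    graphWeight G H z ∈ Set.Icc (0 : ℝ) 1 := prod_edgeWeight_mem_Icc hH _ z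

theorem prod_copyEdges_edgeWeight (hH : ∀ x y, H x y = H y x) {β : Fin k → Fin n}
    (hβ : Function.Injective β) (x : Fin n → E) :
    ∏ e ∈ copyEdges G β, edgeWeight H e x = graphWeight G H fun a => x (β a) := by
  rw [prod_copyEdges hβ, graphWeight]
  refine Finset.prod_congr rfl fun e _ => ?_
  induction e using Sym2.ind with
  | _ a b => rw [Sym2.map_mk, edgeWeight_mk hH, edgeWeight_mk hH]

variable [MeasurableSpace E]

theorem measurable_graphWeight (hHm : Measurable fun z : E × E => H z.1 z.2) :
    Measurable (graphWeight G H) :=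
  Finset.measurable_fun_prod _ fun e _ => measurable_edgeWeight hHm e

variable (G H) (μ : Measure E)

/-- The conditional mean of `graphWeight` given the position of one vertex. -/
noncomputable def projWeight (ℓ : Fin k) (x : E) : ℝ :=
  ∫ z, graphWeight G H (Function.update z ℓ x) ∂(Measure.pi fun _ => μ)

/-- The sum of the one-vertex projections of `graphWeight`. -/
noncomputable def projSum (x : E) : ℝ := ∑ ℓ, projWeight G H μ ℓ x

variable {G H μ} [IsProbabilityMeasure μ]

theorem measurable_projWeight (hHm : Measurable fun z : E × E => H z.1 z.2) (ℓ : Fin k) :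
    Measurable (projWeight G H μ ℓ) := by
  have h1 : Measurable fun w : (Fin k → E) × E => graphWeight G H (Function.update w.1 ℓ w.2) :=
    (measurable_graphWeight hHm).comp (measurePreserving_update μ ℓ).measurable
  exact h1.stronglyMeasurable.integral_prod_left'.measurable

theorem projWeight_mem_Icc (hH : ∀ x y, H x y ∈ Set.Icc (0 : ℝ) 1) (ℓ : Fin k) (x : E) :
    projWeight G H μ ℓ x ∈ Set.Icc (0 : ℝ) 1 :=
  integral_mem_Icc_zero_one fun _ => graphWeight_mem_Icc hH _

theorem measurable_projSum (hHm : Measurable fun z : E × E => H z.1 z.2) :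
    Measurable (projSum G H μ) :=
  Finset.measurable_fun_sum _ fun ℓ _ => measurable_projWeight hHm ℓ

theorem projSum_mem_Icc (hH : ∀ x y, H x y ∈ Set.Icc (0 : ℝ) 1) (x : E) :
    projSum G H μ x ∈ Set.Icc (0 : ℝ) k := by
  refine ⟨Finset.sum_nonneg fun ℓ _ => (projWeight_mem_Icc hH ℓ x).1, ?_⟩
  calc projSum G H μ x ≤ ∑ _ℓ : Fin k, (1 : ℝ) :=
        Finset.sum_le_sum fun ℓ _ => (projWeight_mem_Icc hH ℓ x).2
    _ = k := by simp

theorem integral_graphWeight_mul (hHm : Measurable fun z : E × E => H z.1 z.2)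
    (hH : ∀ x y, H x y ∈ Set.Icc (0 : ℝ) 1) (ℓ : Fin k) {φ : E → ℝ} (hφ : Measurable φ) {B : ℝ}
    (hB : ∀ x, |φ x| ≤ B) :
    ∫ z, graphWeight G H z * φ (z ℓ) ∂(Measure.pi fun _ => μ) =
      ∫ x, projWeight G H μ ℓ x * φ x ∂μ := by
  have mp := measurePreserving_update (ι := Fin k) μ ℓ
  have hm : Measurable fun z : Fin k → E => graphWeight G H z * φ (z ℓ) :=
    (measurable_graphWeight hHm).mul (hφ.comp (measurable_pi_apply ℓ))
  have hb : ∀ z : Fin k → E, ‖graphWeight G H z * φ (z ℓ)‖ ≤ B := by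
    intro z
    have h1 := graphWeight_mem_Icc (G := G) hH z
    rw [norm_mul, Real.norm_eq_abs, Real.norm_eq_abs, abs_of_nonneg h1.1]
    exact (mul_le_of_le_one_left (abs_nonneg _) h1.2).trans (hB _)
  have hint : Integrable (fun w : (Fin k → E) × E => graphWeight G H (Function.update w.1 ℓ w.2) *
      φ (Function.update w.1 ℓ w.2 ℓ)) ((Measure.pi fun _ => μ).prod μ) :=
    Integrable.of_bound (hm.comp mp.measurable).aestronglyMeasurable B (ae_of_all _ fun w => hb _)
  rw [← mp.map_eq, integral_map mp.measurable.aemeasurable hm.aestronglyMeasurable,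
    integral_prod_symm _ hint]
  congr 1
  funext x
  simp only [Function.update_self]
  rw [integral_mul_const]
  rfl

theorem integrable_projWeight (hHm : Measurable fun z : E × E => H z.1 z.2)
    (hH : ∀ x y, H x y ∈ Set.Icc (0 : ℝ) 1) (ℓ : Fin k) : Integrable (projWeight G H μ ℓ) μ :=
  Integrable.of_bound (measurable_projWeight hHm ℓ).aestronglyMeasurable 1
    (ae_of_all _ fun x => by
      have := projWeight_mem_Icc (G := G) (μ := μ) hH ℓ x
      rw [Real.norm_eq_abs, abs_of_nonneg this.1]
      exact this.2)

theorem integral_projSum (hHm : Measurable fun z : E × E => H z.1 z.2)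
    (hH : ∀ x y, H x y ∈ Set.Icc (0 : ℝ) 1) :
    ∫ x, projSum G H μ x ∂μ = k * ∫ z, graphWeight G H z ∂(Measure.pi fun _ => μ) := by
  unfold projSum
  rw [integral_finsetSum _ fun ℓ _ => integrable_projWeight hHm hH ℓ]
  have h1 : ∀ ℓ : Fin k, ∫ x, projWeight G H μ ℓ x ∂μ =
      ∫ z, graphWeight G H z ∂(Measure.pi fun _ => μ) := by
    intro ℓ
    have := integral_graphWeight_mul (G := G) (μ := μ) hHm hH ℓ (φ := fun _ => 1)
      measurable_const (B := 1) (fun _ => by simp)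
    simpa using this.symm
  simp [h1]

theorem memLp_projSum (hHm : Measurable fun z : E × E => H z.1 z.2)
    (hH : ∀ x y, H x y ∈ Set.Icc (0 : ℝ) 1) : MemLp (projSum G H μ) 2 μ :=
  MemLp.of_bound (measurable_projSum hHm).aestronglyMeasurable k
    (ae_of_all _ fun x => by
      have := projSum_mem_Icc (G := G) (μ := μ) hH x
      rw [Real.norm_eq_abs, abs_of_nonneg this.1]
      exact this.2)

theorem variance_projSum_le (hHm : Measurable fun z : E × E => H z.1 z.2)
    (hH : ∀ x y, H x y ∈ Set.Icc (0 : ℝ) 1) :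
    variance (projSum G H μ) μ ≤ k ^ 2 * ∫ z, graphWeight G H z ∂(Measure.pi fun _ => μ) := by
  have hL := memLp_projSum (G := G) (μ := μ) hHm hH
  rw [variance_eq_sub hL]
  calc _ ≤ ∫ x, (projSum G H μ ^ 2) x ∂μ := sub_le_self _ (sq_nonneg _)
    _ ≤ ∫ x, k * projSum G H μ x ∂μ := by
        refine integral_mono hL.integrable_sq ((hL.integrable one_le_two).const_mul _) fun x => ?_
        have := projSum_mem_Icc (G := G) (μ := μ) hH x
        simp only [Pi.pow_apply, sq]
        exact mul_le_mul_of_nonneg_right this.2 this.1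
    _ = _ := by rw [integral_const_mul, integral_projSum hHm hH]; ring

theorem edgeMoment_copyEdges (hHm : Measurable fun z : E × E => H z.1 z.2)
    (hH : ∀ x y, H x y = H y x) (p : ℝ) {β : Fin k → Fin n} (hβ : Function.Injective β) :
    edgeMoment μ H p (copyEdges G β) =
      p ^ G.edgeFinset.card * ∫ z, graphWeight G H z ∂(Measure.pi fun _ => μ) := by
  rw [edgeMoment, card_copyEdges hβ]
  simp_rw [prod_copyEdges_edgeWeight hH hβ]
  have mp := measurePreserving_precomp μ β hβ
  rw [← mp.map_eq, integral_map mp.measurable.aemeasurable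
    (measurable_graphWeight hHm).aestronglyMeasurable]

end GraphWeight

theorem fSub_eq {d k : ℕ} (G : SimpleGraph (Fin k)) [DecidableRel G.Adj]
    {H : (Fin d → ℝ) → (Fin d → ℝ) → ℝ} (hH : ∀ x y, H x y = H y x) (μ : Measure (Fin d → ℝ))
    (p : ℝ) (a : ℕ) (ℓ : Fin k) (x : Fin d → ℝ) :
    fSub G H μ p a ℓ x = p ^ G.edgeFinset.card / a * projWeight G H μ ℓ x := by
  unfold fSub projWeight graphWeight
  congr 2
  funext z
  rw [← prod_filter_adj]
  refine Finset.prod_congr rfl fun q _ => ?_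
  rw [edgeWeight_mk hH]

theorem variance_sum_fSub {d k : ℕ} (G : SimpleGraph (Fin k)) [DecidableRel G.Adj]
    {H : (Fin d → ℝ) → (Fin d → ℝ) → ℝ} (hH : ∀ x y, H x y = H y x) (μ : Measure (Fin d → ℝ))
    (p : ℝ) (a : ℕ) :
    variance (fun x => ∑ ℓ : Fin k, fSub G H μ p a ℓ x) μ =
      (p ^ G.edgeFinset.card / a) ^ 2 * variance (projSum G H μ) μ := by
  rw [← variance_const_mul]
  congr 1
  funext x
  simp_rw [fSub_eq G hH]
  rw [← Finset.mul_sum]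
  rfl

section Variance

variable {k n : ℕ} {G : SimpleGraph (Fin k)} [DecidableRel G.Adj]

theorem div_two_pow_le_card_injective (h : 2 * k ≤ n) :
    ((n : ℝ) / 2) ^ k ≤ Fintype.card {β : Fin k → Fin n // Function.Injective β} := by
  rw [Fintype.card_congr (Equiv.subtypeInjectiveEquivEmbedding _ _), Fintype.card_embedding_eq,
    Fintype.card_fin, Fintype.card_fin]
  have h1 : ((n + 1 - k : ℕ) : ℝ) ^ k ≤ n.descFactorial k := by
    exact_mod_cast Nat.pow_sub_le_descFactorial n k
  refine le_trans (pow_le_pow_left₀ (by positivity) ?_ k) h1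
  rw [div_le_iff₀ two_pos]
  norm_cast
  omega

theorem card_injective_le :
    Fintype.card {β : Fin k → Fin n // Function.Injective β} ≤ n ^ k :=
  (Fintype.card_subtype_le _).trans (by simp)

theorem card_not_disjoint_le (β : Fin k → Fin n) :
    (univ.filter fun β' : {β : Fin k → Fin n // Function.Injective β} =>
      ¬ Disjoint (copyVerts β) (copyVerts β'.1)).card ≤ k ^ 2 * n ^ (k - 1) := by
  have h1 : ∀ (b : Fin k) (v : Fin n),
      (univ.filter fun f : Fin k → Fin n => f b = v).card ≤ n ^ (k - 1) := by
    intro b v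
    have hs : (univ.filter fun f : Fin k → Fin n => f b = v) ⊆
        Fintype.piFinset (Function.update (fun _ => univ) b {v}) := by
      intro f hf
      rw [Fintype.mem_piFinset]
      intro i
      by_cases hi : i = b
      · subst hi
        simpa using hf
      · simp [hi]
    refine (card_le_card hs).trans ?_
    rw [Fintype.card_piFinset, ← Finset.mul_prod_erase univ _ (mem_univ b)]
    rw [Finset.prod_congr rfl (g := fun _ => n) fun i hi => by
      simp [Finset.ne_of_mem_erase hi]]
    simp
  calc _ ≤ ((univ : Finset (Fin k × Fin k)).biUnion fun q =>
          univ.filter fun f : Fin k → Fin n => f q.2 = β q.1).card := by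
        refine card_le_card_of_injOn Subtype.val ?_ Subtype.val_injective.injOn
        intro β' hβ'
        obtain ⟨v, hv, hv'⟩ := Finset.not_disjoint_iff.1 (mem_filter.1 hβ').2
        obtain ⟨a, -, rfl⟩ := mem_image.1 hv
        obtain ⟨b, -, hb⟩ := mem_image.1 hv'
        exact mem_biUnion.2 ⟨(a, b), mem_univ _, mem_filter.2 ⟨mem_univ _, hb⟩⟩
    _ ≤ (univ : Finset (Fin k × Fin k)).card * n ^ (k - 1) :=
        card_biUnion_le_card_mul _ _ _ fun q _ => h1 _ _
    _ = k ^ 2 * n ^ (k - 1) := by simp [sq]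

variable {d : ℕ} {Ω : Type*} [MeasurableSpace Ω] {μ : Measure (Fin d → ℝ)}
  {H : (Fin d → ℝ) → (Fin d → ℝ) → ℝ} {p : ℝ} {P : Measure Ω} {X : Fin n → Ω → Fin d → ℝ}
  {Y : Fin n → Fin n → Ω → ℝ}

/-- The number of labelled copies of a graph. -/
noncomputable def labelledCount (G : SimpleGraph (Fin k)) [DecidableRel G.Adj]
    (H : (Fin d → ℝ) → (Fin d → ℝ) → ℝ) (p : ℝ) (X : Fin n → Ω → Fin d → ℝ)
    (Y : Fin n → Fin n → Ω → ℝ) (ω : Ω) : ℝ :=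
  ∑ β : {β : Fin k → Fin n // Function.Injective β}, ∏ e ∈ copyEdges G β.1, edgeInd H p X Y e ω

theorem IsRCM.variance_NG (h : IsRCM μ H p P X Y) (a : ℕ) :
    variance (NG G H p a X Y) P = ((a : ℝ)⁻¹) ^ 2 * variance (labelledCount G H p X Y) P := by
  rw [← variance_const_mul]
  congr 1
  funext ω
  exact h.NG_eq a ω

variable [IsProbabilityMeasure μ]

theorem IsRCM.integral_comp_X (h : IsRCM μ H p P X Y) {φ : (Fin n → Fin d → ℝ) → ℝ}
    (hφ : Measurable φ) {C : ℝ} (hC : ∀ x, |φ x| ≤ C) :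
    ∫ ω, φ (fun i => X i ω) ∂P = ∫ x, φ x ∂(Measure.pi fun _ => μ) := by
  simpa using h.integral_prod_edgeInd_mul ∅ (by simp) hφ hC

/-- The covariance of a copy with a centered function of one vertex. -/
theorem IsRCM.integral_prod_edgeInd_mul_comp (h : IsRCM μ H p P X Y)
    {β : Fin k → Fin n} (hβ : Function.Injective β) {ψ : (Fin d → ℝ) → ℝ} (hψ : Measurable ψ)
    {C : ℝ} (hC : ∀ x, |ψ x| ≤ C) (hψ0 : ∫ x, ψ x ∂μ = 0) :
    ∑ i, ∫ ω, (∏ e ∈ copyEdges G β, edgeInd H p X Y e ω) * ψ (X i ω) ∂P =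
      p ^ G.edgeFinset.card * ∫ x, projSum G H μ x * ψ x ∂μ := by
  have h1 : ∀ i, ∫ ω, (∏ e ∈ copyEdges G β, edgeInd H p X Y e ω) * ψ (X i ω) ∂P =
      p ^ G.edgeFinset.card *
        ∫ x, graphWeight G H (fun a => x (β a)) * ψ (x i) ∂(Measure.pi fun _ : Fin n => μ) := by
    intro i
    rw [h.integral_prod_edgeInd_mul (φ := fun x => ψ (x i)) _
      (fun e he => not_isDiag_of_mem_copyEdges hβ he) (hψ.comp (measurable_pi_apply i))
      (fun x => hC _), card_copyEdges hβ]
    simp_rw [prod_copyEdges_edgeWeight h.symm hβ]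
  have hm : ∀ ℓ : Fin k, Measurable fun z : Fin k → Fin d → ℝ => graphWeight G H z * ψ (z ℓ) :=
    fun ℓ => (measurable_graphWeight h.measurable).mul (hψ.comp (measurable_pi_apply ℓ))
  have h2 : ∀ ℓ, ∫ x, graphWeight G H (fun a => x (β a)) * ψ (x (β ℓ))
      ∂(Measure.pi fun _ : Fin n => μ) = ∫ x, projWeight G H μ ℓ x * ψ x ∂μ := by
    intro ℓ
    rw [← integral_graphWeight_mul h.measurable h.mem_Icc ℓ hψ hC]
    have mp := measurePreserving_precomp μ β hβ
    rw [← mp.map_eq, integral_map mp.measurable.aemeasurable (hm ℓ).aestronglyMeasurable]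
  have h3 : ∀ i ∉ copyVerts β, ∫ x, graphWeight G H (fun a => x (β a)) * ψ (x i)
      ∂(Measure.pi fun _ : Fin n => μ) = 0 := by
    intro i hi
    rw [integral_mul_of_dependsOn μ (φ := fun x => graphWeight G H fun a => x (β a))
      (ψ := fun x => ψ (x i)) (S := copyVerts β) (T := {i})]
    · rw [integral_eval_pi hψ, hψ0, mul_zero]
    · intro x y hxy
      have : (fun a => x (β a)) = fun a => y (β a) := by
        funext a
        exact hxy _ (mem_image_of_mem _ (mem_univ _))
      simp only [this]
    · intro x y hxy
      simp only [hxy i rfl]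
    · rw [Set.disjoint_singleton_right]
      exact hi
  simp_rw [h1]
  rw [← Finset.mul_sum]
  congr 1
  rw [← Finset.sum_subset (subset_univ (copyVerts β)) fun i _ hi => h3 i hi, copyVerts,
    Finset.sum_image fun _ _ _ _ hab => hβ hab]
  simp_rw [h2]
  rw [← integral_finsetSum]
  · simp_rw [projSum, Finset.sum_mul]
  · intro ℓ _
    refine (integrable_projWeight h.measurable h.mem_Icc ℓ).mul_bdd (c := C)
      hψ.aestronglyMeasurable (ae_of_all _ hC)

variable [IsProbabilityMeasure P]

theorem IsRCM.memLp_labelledCount (h : IsRCM μ H p P X Y) :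
    MemLp (labelledCount G H p X Y) 2 P := by
  refine memLp_finsetSum _ fun β _ => ?_
  have hi := h.integrable_prod_edgeInd (U := copyEdges G β.1)
    fun e he => not_isDiag_of_mem_copyEdges β.2 he
  refine MemLp.of_bound hi.aestronglyMeasurable 1 (ae_of_all _ fun ω => ?_)
  rw [Real.norm_eq_abs, abs_of_nonneg (Finset.prod_nonneg fun e _ => edgeInd_nonneg H p X Y e ω)]
  exact Finset.prod_le_one (fun e _ => edgeInd_nonneg H p X Y e ω)
    fun e _ => edgeInd_le_one H p X Y e ω

theorem IsRCM.integral_labelledCount (h : IsRCM μ H p P X Y) :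
    ∫ ω, labelledCount G H p X Y ω ∂P =
      Fintype.card {β : Fin k → Fin n // Function.Injective β} *
        (p ^ G.edgeFinset.card * ∫ z, graphWeight G H z ∂(Measure.pi fun _ => μ)) := by
  unfold labelledCount
  have hU : ∀ β : {β : Fin k → Fin n // Function.Injective β}, ∀ e ∈ copyEdges G β.1, ¬ e.IsDiag :=
    fun β e he => not_isDiag_of_mem_copyEdges β.2 he
  rw [integral_finsetSum _ fun β _ => h.integrable_prod_edgeInd (hU β)]
  rw [Finset.sum_congr rfl fun β _ => (h.integral_prod_edgeInd _ (hU β)).trans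
    (edgeMoment_copyEdges h.measurable h.symm p β.2)]
  simp

theorem IsRCM.integral_labelledCount_sq (h : IsRCM μ H p P X Y) :
    ∫ ω, labelledCount G H p X Y ω ^ 2 ∂P =
      ∑ β : {β : Fin k → Fin n // Function.Injective β},
        ∑ β' : {β : Fin k → Fin n // Function.Injective β},
          edgeMoment μ H p (copyEdges G β.1 ∪ copyEdges G β'.1) := by
  have hU : ∀ β β' : {β : Fin k → Fin n // Function.Injective β},
      ∀ e ∈ copyEdges G β.1 ∪ copyEdges G β'.1, ¬ e.IsDiag := by
    intro β β' e he
    rcases mem_union.1 he with he | he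
    · exact not_isDiag_of_mem_copyEdges β.2 he
    · exact not_isDiag_of_mem_copyEdges β'.2 he
  have h1 : ∀ ω, labelledCount G H p X Y ω ^ 2 =
      ∑ β : {β : Fin k → Fin n // Function.Injective β},
        ∑ β' : {β : Fin k → Fin n // Function.Injective β},
          ∏ e ∈ copyEdges G β.1 ∪ copyEdges G β'.1, edgeInd H p X Y e ω := by
    intro ω
    rw [sq, labelledCount, Finset.sum_mul_sum]
    refine Finset.sum_congr rfl fun β _ => Finset.sum_congr rfl fun β' _ => ?_
    exact prod_idem_union _ (fun e => edgeInd_mul_self H p X Y e ω) _ _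
  simp_rw [h1]
  rw [integral_finsetSum _ fun β _ => integrable_finsetSum _ fun β' _ =>
    h.integrable_prod_edgeInd (hU β β')]
  refine Finset.sum_congr rfl fun β _ => ?_
  rw [integral_finsetSum _ fun β' _ => h.integrable_prod_edgeInd (hU β β')]
  exact Finset.sum_congr rfl fun β' _ => h.integral_prod_edgeInd _ (hU β β')

/-- The variance lower bound coming from the randomness of the edges. -/
theorem IsRCM.le_variance_of_sparse (h : IsRCM μ H p P X Y) (hk : k ≠ 0) {q : ℝ}
    (hq : q = p ^ G.edgeFinset.card * ∫ z, graphWeight G H z ∂(Measure.pi fun _ => μ)) :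
    Fintype.card {β : Fin k → Fin n // Function.Injective β} * q -
        (n : ℝ) ^ k * ((k : ℝ) ^ 2 * (n : ℝ) ^ (k - 1)) * q ^ 2 ≤
      variance (labelledCount G H p X Y) P := by
  let B := {β : Fin k → Fin n // Function.Injective β}
  have hem : ∀ β : B, edgeMoment μ H p (copyEdges G β.1) = q := fun β => by
    rw [hq]
    exact edgeMoment_copyEdges h.measurable h.symm p β.2
  have hvar : variance (labelledCount G H p X Y) P =
      ∑ β : B, ∑ β' : B, (edgeMoment μ H p (copyEdges G β.1 ∪ copyEdges G β'.1) - q ^ 2) := by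
    rw [variance_eq_sub h.memLp_labelledCount]
    simp only [Pi.pow_apply]
    rw [h.integral_labelledCount_sq, h.integral_labelledCount, ← hq]
    simp only [Finset.sum_sub_distrib, Finset.sum_const, card_univ, nsmul_eq_mul]
    ring
  have hterm : ∀ β β' : B, (if β = β' then q else 0) -
      (if ¬ Disjoint (copyVerts β.1) (copyVerts β'.1) then q ^ 2 else 0) ≤
        edgeMoment μ H p (copyEdges G β.1 ∪ copyEdges G β'.1) - q ^ 2 := by
    intro β β'
    have h0 := (edgeMoment_mem_Icc (μ := μ) h.mem_Icc h.p_mem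
      (copyEdges G β.1 ∪ copyEdges G β'.1)).1
    by_cases hd : Disjoint (copyVerts β.1) (copyVerts β'.1)
    · have hm : edgeMoment μ H p (copyEdges G β.1 ∪ copyEdges G β'.1) = q ^ 2 := by
        rw [edgeMoment_union (S := copyVerts β.1) (T := copyVerts β'.1)
          (fun e he v hv => mem_copyVerts_of_mem_copyEdges he hv)
          (fun e he v hv => mem_copyVerts_of_mem_copyEdges he hv)
          (Finset.disjoint_coe.2 hd), hem, hem, sq]
      rw [hm, if_neg (not_not.2 hd), sub_zero, sub_self]
      split_ifs with hβ
      · subst hβ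
        rw [disjoint_self, bot_eq_empty, ← card_eq_zero, card_copyVerts β.2] at hd
        exact absurd hd hk
      · exact le_rfl
    · rw [if_pos hd]
      refine sub_le_sub_right ?_ _
      split_ifs with hβ
      · subst hβ
        rw [Finset.union_self, hem]
      · exact h0
  rw [hvar]
  refine le_trans ?_ (Finset.sum_le_sum fun β _ => Finset.sum_le_sum fun β' _ => hterm β β')
  simp only [Finset.sum_sub_distrib, Finset.sum_ite_eq, mem_univ, if_true, Finset.sum_const,
    card_univ, nsmul_eq_mul]
  refine sub_le_sub_left ?_ _
  have hrow : ∀ β : B, ∑ β' : B, (if ¬ Disjoint (copyVerts β.1) (copyVerts β'.1) then q ^ 2 else 0)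
      ≤ (k : ℝ) ^ 2 * (n : ℝ) ^ (k - 1) * q ^ 2 := by
    intro β
    rw [← Finset.sum_filter, Finset.sum_const, nsmul_eq_mul]
    refine mul_le_mul_of_nonneg_right ?_ (sq_nonneg q)
    exact_mod_cast card_not_disjoint_le β.1
  refine (Finset.sum_le_sum fun β _ => hrow β).trans ?_
  rw [Finset.sum_const, card_univ, nsmul_eq_mul, mul_assoc ((n : ℝ) ^ k)]
  refine mul_le_mul_of_nonneg_right ?_ (by positivity)
  exact_mod_cast card_injective_le

end Variance

section Variance

theorem sq_integral_mul_le {Ω : Type*} [MeasurableSpace Ω] {P : Measure Ω}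
    [IsProbabilityMeasure P] {L U : Ω → ℝ} (hL : MemLp L 2 P) (hU : MemLp U 2 P)
    (hU0 : ∫ ω, U ω ∂P = 0) (t : ℝ) :
    2 * t * (∫ ω, L ω * U ω ∂P) - t ^ 2 * ∫ ω, U ω ^ 2 ∂P ≤ variance L P := by
  have hL' := hL.integrable one_le_two
  have hU' := hU.integrable one_le_two
  have hLU : Integrable (fun ω => L ω * U ω) P := hL.integrable_mul hU
  have h0 : 0 ≤ ∫ ω, (L ω - (∫ ω', L ω' ∂P) - t * U ω) ^ 2 ∂P :=
    integral_nonneg fun ω => sq_nonneg _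
  have h1 : ∀ ω, (L ω - (∫ ω', L ω' ∂P) - t * U ω) ^ 2 =
      (L ω - (∫ ω', L ω' ∂P)) ^ 2 - 2 * t * (L ω * U ω) +
        (2 * t * (∫ ω', L ω' ∂P) * U ω + t ^ 2 * U ω ^ 2) := fun ω => by ring
  have hLc : Integrable (fun ω => (L ω - (∫ ω', L ω' ∂P)) ^ 2) P :=
    (hL.sub (memLp_const _)).integrable_sq
  simp_rw [h1] at h0
  have i1 : Integrable (fun ω => (L ω - (∫ ω', L ω' ∂P)) ^ 2 - 2 * t * (L ω * U ω)) P :=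
    hLc.sub (hLU.const_mul _)
  have i2 : Integrable (fun ω => 2 * t * (∫ ω', L ω' ∂P) * U ω + t ^ 2 * U ω ^ 2) P :=
    (hU'.const_mul _).add (hU.integrable_sq.const_mul _)
  rw [integral_add i1 i2, integral_sub hLc (hLU.const_mul _),
    integral_add (hU'.const_mul _) (hU.integrable_sq.const_mul _), integral_const_mul,
    integral_const_mul, integral_const_mul, hU0,
    ← variance_eq_integral hL.aestronglyMeasurable.aemeasurable] at h0
  linarith

theorem integral_sum_sq_eq {n : ℕ} {E : Type*} [MeasurableSpace E] {μ : Measure E}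
    [IsProbabilityMeasure μ] {ψ : E → ℝ} (hψ : Measurable ψ) {C : ℝ} (hC : ∀ x, |ψ x| ≤ C)
    (hψ0 : ∫ x, ψ x ∂μ = 0) :
    ∫ x, (∑ i, ψ (x i)) ^ 2 ∂(Measure.pi fun _ : Fin n => μ) = n * ∫ x, ψ x ^ 2 ∂μ := by
  have hint : ∀ i i' : Fin n, Integrable (fun x : Fin n → E => ψ (x i) * ψ (x i'))
      (Measure.pi fun _ => μ) := by
    intro i i'
    refine Integrable.of_bound ((hψ.comp (measurable_pi_apply i)).mul
      (hψ.comp (measurable_pi_apply i'))).aestronglyMeasurable (C * C) (ae_of_all _ fun x => ?_)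
    rw [norm_mul]
    exact mul_le_mul (hC _) (hC _) (norm_nonneg _) ((abs_nonneg _).trans (hC (x i)))
  have hpair : ∀ i i' : Fin n, ∫ x, ψ (x i) * ψ (x i') ∂(Measure.pi fun _ : Fin n => μ) =
      if i = i' then ∫ x, ψ x ^ 2 ∂μ else 0 := by
    intro i i'
    split_ifs with hi
    · subst hi
      simp_rw [← sq]
      exact integral_eval_pi (φ := fun x => ψ x ^ 2) (hψ.pow_const 2) i
    · rw [integral_mul_of_dependsOn μ (φ := fun x => ψ (x i)) (ψ := fun x => ψ (x i'))
        (S := {i}) (T := {i'}) (fun x y hxy => by simp only [hxy i rfl])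
        (fun x y hxy => by simp only [hxy i' rfl]) (by simpa using hi), integral_eval_pi hψ, hψ0, zero_mul]
  simp_rw [sq (∑ i, ψ _), Finset.sum_mul_sum]
  rw [integral_finsetSum _ fun i _ => integrable_finsetSum _ fun i' _ => hint i i']
  simp_rw [integral_finsetSum _ fun i' _ => hint _ i', hpair]
  simp

variable {k n : ℕ} {G : SimpleGraph (Fin k)} [DecidableRel G.Adj]
  {d : ℕ} {Ω : Type*} [MeasurableSpace Ω] {μ : Measure (Fin d → ℝ)}
  {H : (Fin d → ℝ) → (Fin d → ℝ) → ℝ} {p : ℝ} {P : Measure Ω} {X : Fin n → Ω → Fin d → ℝ}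
  {Y : Fin n → Fin n → Ω → ℝ} [IsProbabilityMeasure μ] [IsProbabilityMeasure P]

theorem IsRCM.memLp_comp_X (h : IsRCM μ H p P X Y) {φ : (Fin n → Fin d → ℝ) → ℝ}
    (hφ : Measurable φ) {C : ℝ} (hC : ∀ x, |φ x| ≤ C) : MemLp (fun ω => φ fun i => X i ω) 2 P :=
  MemLp.of_bound (hφ.comp_aemeasurable h.aemeasurable_X).aestronglyMeasurable C
    (ae_of_all _ fun _ => hC _)

/-- The covariance of the labelled count with an additive function of the vertices. -/
theorem IsRCM.integral_labelledCount_mul_sum (h : IsRCM μ H p P X Y) {ψ : (Fin d → ℝ) → ℝ}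
    (hψ : Measurable ψ) {C : ℝ} (hC : ∀ x, |ψ x| ≤ C) (hψ0 : ∫ x, ψ x ∂μ = 0) :
    ∫ ω, labelledCount G H p X Y ω * ∑ i, ψ (X i ω) ∂P =
      Fintype.card {β : Fin k → Fin n // Function.Injective β} *
        (p ^ G.edgeFinset.card * ∫ x, projSum G H μ x * ψ x ∂μ) := by
  have hi : ∀ (β : {β : Fin k → Fin n // Function.Injective β}) (i : Fin n),
      Integrable (fun ω => (∏ e ∈ copyEdges G β.1, edgeInd H p X Y e ω) * ψ (X i ω)) P := by
    intro β i
    exact (h.integrable_prod_edgeInd fun e he => not_isDiag_of_mem_copyEdges β.2 he).mul_bdd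
      (c := C) (h.memLp_comp_X (φ := fun x => ψ (x i)) (hψ.comp (measurable_pi_apply i))
        fun _ => hC _).aestronglyMeasurable (ae_of_all _ fun ω => hC _)
  simp_rw [labelledCount, Finset.sum_mul_sum]
  rw [integral_finsetSum _ fun β _ => integrable_finsetSum _ fun i _ => hi β i]
  rw [Finset.sum_congr rfl fun β _ => (integral_finsetSum _ fun i _ => hi β i).trans
    (h.integral_prod_edgeInd_mul_comp β.2 hψ hC hψ0)]
  rw [Finset.sum_const, card_univ, nsmul_eq_mul]

theorem IsRCM.le_variance_labelledCount (h : IsRCM μ H p P X Y) {ψ : (Fin d → ℝ) → ℝ}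
    (hψ : Measurable ψ) {C : ℝ} (hC : ∀ x, |ψ x| ≤ C) (hψ0 : ∫ x, ψ x ∂μ = 0) (t : ℝ) :
    2 * t * (Fintype.card {β : Fin k → Fin n // Function.Injective β} *
        (p ^ G.edgeFinset.card * ∫ x, projSum G H μ x * ψ x ∂μ)) -
      t ^ 2 * (n * ∫ x, ψ x ^ 2 ∂μ) ≤ variance (labelledCount G H p X Y) P := by
  have hSm : Measurable fun x : Fin n → Fin d → ℝ => ∑ i, ψ (x i) :=
    Finset.measurable_fun_sum _ fun i _ => hψ.comp (measurable_pi_apply i)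
  have hSb : ∀ x : Fin n → Fin d → ℝ, |∑ i, ψ (x i)| ≤ n * C := by
    intro x
    refine (Finset.abs_sum_le_sum_abs _ _).trans ((Finset.sum_le_sum fun i _ => hC _).trans ?_)
    simp
  have hU0 : ∫ ω, ∑ i, ψ (X i ω) ∂P = 0 := by
    rw [h.integral_comp_X (φ := fun x => ∑ i, ψ (x i)) hSm hSb, integral_finsetSum]
    · exact Finset.sum_eq_zero fun i _ => (integral_eval_pi hψ i).trans hψ0
    · intro i _
      exact Integrable.of_bound (hψ.comp (measurable_pi_apply i)).aestronglyMeasurable C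
        (ae_of_all _ fun _ => hC _)
  have hU2 : ∫ ω, (∑ i, ψ (X i ω)) ^ 2 ∂P = n * ∫ x, ψ x ^ 2 ∂μ := by
    rw [h.integral_comp_X (φ := fun x => (∑ i, ψ (x i)) ^ 2) (hSm.pow_const 2) (C := (n * C) ^ 2)
      fun x => ?_, integral_sum_sq_eq hψ hC hψ0]
    rw [abs_pow]
    exact pow_le_pow_left₀ (abs_nonneg _) (hSb x) 2
  have := sq_integral_mul_le (L := labelledCount G H p X Y) h.memLp_labelledCount
    (h.memLp_comp_X hSm hSb) hU0 t
  rwa [h.integral_labelledCount_mul_sum hψ hC hψ0, hU2] at this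

/-- The variance lower bound coming from the randomness of the vertices. -/
theorem IsRCM.le_variance_of_dense (h : IsRCM μ H p P X Y) (hn : 0 < n) :
    (Fintype.card {β : Fin k → Fin n // Function.Injective β} * p ^ G.edgeFinset.card) ^ 2 *
        variance (projSum G H μ) μ ≤ n * variance (labelledCount G H p X Y) P := by
  have hg := memLp_projSum (G := G) (μ := μ) h.measurable h.mem_Icc
  have hgm := measurable_projSum (G := G) (μ := μ) h.measurable
  have hgb := projSum_mem_Icc (G := G) (μ := μ) h.mem_Icc
  have hVdef := variance_eq_integral (μ := μ) hgm.aemeasurable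
  generalize variance (projSum G H μ) μ = V at hVdef ⊢
  generalize hm : ∫ y, projSum G H μ y ∂μ = m at hVdef
  have hgi := hg.integrable one_le_two
  have hψ0 : ∫ x, (projSum G H μ x - m) ∂μ = 0 := by
    rw [integral_sub hgi (integrable_const _)]
    simp [hm]
  have hgV : ∫ x, projSum G H μ x * (projSum G H μ x - m) ∂μ = V := by
    have hψi : Integrable (fun x => projSum G H μ x - m) μ := hgi.sub (integrable_const _)
    have hψ2 : Integrable (fun x => (projSum G H μ x - m) ^ 2) μ :=
      (hg.sub (memLp_const _)).integrable_sq
    have : ∀ x, projSum G H μ x * (projSum G H μ x - m) =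
        (projSum G H μ x - m) ^ 2 + m * (projSum G H μ x - m) := fun x => by ring
    simp_rw [this]
    rw [integral_add hψ2 (hψi.const_mul _), integral_const_mul, hψ0, ← hVdef]
    ring
  have key := h.le_variance_labelledCount (G := G) (hgm.sub_const m) (C := k + |m|) (fun x => by
    refine (abs_sub _ _).trans ?_
    rw [abs_of_nonneg (hgb x).1]
    linarith [(hgb x).2]) hψ0
    (Fintype.card {β : Fin k → Fin n // Function.Injective β} * p ^ G.edgeFinset.card / n)
  rw [hgV, ← hVdef] at key
  have hn' : (0 : ℝ) < n := by exact_mod_cast hn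
  rw [← div_le_iff₀' hn']
  refine le_trans (le_of_eq ?_) key
  field_simp
  ring

end Variance

section Growth

theorem natCast_pow_self_le_exp_mul_factorial (j : ℕ) :
    (j : ℝ) ^ j ≤ Real.exp 1 ^ j * j.factorial := by
  have := Real.pow_div_factorial_le_exp (j : ℝ) (Nat.cast_nonneg j) j
  rw [div_le_iff₀ (by positivity)] at this
  rwa [← Real.exp_nat_mul, mul_one]

/-- The combinatorial factors are bounded by a power of a factorial. -/
theorem pow_self_mul_pow_mul_le (j k : ℕ) :
    (j : ℝ) ^ j * ((j * k : ℕ) : ℝ) ^ (j * k) ≤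
      (j.factorial : ℝ) ^ (1 + k) * (Real.exp 1 ^ (1 + k) * (k : ℝ) ^ k) ^ j := by
  calc (j : ℝ) ^ j * ((j * k : ℕ) : ℝ) ^ (j * k)
      = ((j : ℝ) ^ j) ^ (1 + k) * ((k : ℝ) ^ k) ^ j := by
        push_cast
        rw [mul_pow, pow_mul (j : ℝ) j k, mul_comm j k, pow_mul (k : ℝ) k j]
        ring
    _ ≤ (Real.exp 1 ^ j * j.factorial) ^ (1 + k) * ((k : ℝ) ^ k) ^ j := by
        gcongr
        exact natCast_pow_self_le_exp_mul_factorial j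
    _ = _ := by
        rw [mul_pow, mul_pow, ← pow_mul, ← pow_mul, mul_comm j (1 + k)]
        ring

/-- A variance lower bound turns a cumulant bound into a normalized one. -/
theorem div_sqrt_pow_mul_le {k j : ℕ} (hj : 3 ≤ j) {c T D v A : ℝ} (hc : 0 < c) (hT : 0 < T)
    (hD : 0 < D) (hv : c * T * D ^ 2 ≤ v) (hA : 1 ≤ A)
    (hA' : Real.exp 1 ^ (1 + k) * (k : ℝ) ^ k / √c ≤ A) :
    (1 / √v) ^ j * ((j : ℝ) ^ j * ((T * D * D ^ (j - 1)) * ((j * k : ℕ) : ℝ) ^ (j * k))) ≤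
      (j.factorial : ℝ) ^ (1 + k) / ((A ^ 6)⁻¹ * T) ^ ((j : ℝ) / 2 - 1) := by
  have hs : √c * √T * D ≤ √v := by
    rw [← Real.sqrt_mul hc.le, ← Real.sqrt_sq hD.le, ← Real.sqrt_mul (by positivity)]
    exact Real.sqrt_le_sqrt hv
  have hsc := Real.sqrt_pos.2 hc
  have hsT := Real.sqrt_pos.2 hT
  have hDj : D * D ^ (j - 1) = D ^ j := by
    rw [← pow_succ']
    congr 1
    omega
  have hA0 : 0 < A := by linarith
  have hTj : (1 / √T) ^ j * T = (T ^ ((j : ℝ) / 2 - 1))⁻¹ := by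
    rw [Real.rpow_sub hT, Real.rpow_one, inv_div, div_pow, one_pow, ← Real.rpow_natCast,
      Real.sqrt_eq_rpow, ← Real.rpow_mul hT.le, one_div_mul_eq_div,
      one_div_mul_eq_div]
  have hAj : A ^ j ≤ ((A ^ 6)⁻¹ ^ ((j : ℝ) / 2 - 1))⁻¹ := by
    rw [Real.inv_rpow (by positivity), inv_inv, ← Real.rpow_natCast, ← Real.rpow_natCast A 6,
      ← Real.rpow_mul hA0.le]
    refine Real.rpow_le_rpow_of_exponent_le hA ?_
    have : (3 : ℝ) ≤ j := by exact_mod_cast hj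
    push_cast
    linarith
  calc (1 / √v) ^ j * ((j : ℝ) ^ j * ((T * D * D ^ (j - 1)) * ((j * k : ℕ) : ℝ) ^ (j * k)))
      = (1 / √v) ^ j * (T * D ^ j) * ((j : ℝ) ^ j * ((j * k : ℕ) : ℝ) ^ (j * k)) := by
        rw [← hDj]
        ring
    _ ≤ (1 / (√c * √T * D)) ^ j * (T * D ^ j) *
        ((j.factorial : ℝ) ^ (1 + k) * (Real.exp 1 ^ (1 + k) * (k : ℝ) ^ k) ^ j) := by
        exact mul_le_mul (by gcongr) (pow_self_mul_pow_mul_le j k) (by positivity) (by positivity)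
    _ = (j.factorial : ℝ) ^ (1 + k) * ((Real.exp 1 ^ (1 + k) * (k : ℝ) ^ k / √c) ^ j *
          ((1 / √T) ^ j * T)) := by
        generalize Real.exp 1 ^ (1 + k) * (k : ℝ) ^ k = B
        simp only [div_pow, mul_pow, one_pow]
        field_simp
    _ ≤ (j.factorial : ℝ) ^ (1 + k) * (((A ^ 6)⁻¹ ^ ((j : ℝ) / 2 - 1))⁻¹ *
          (T ^ ((j : ℝ) / 2 - 1))⁻¹) := by
        rw [hTj]
        gcongr
        refine le_trans ?_ hAj
        gcongr
    _ = _ := by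
        rw [Real.mul_rpow (by positivity) hT.le, ← mul_inv, ← div_eq_mul_inv]

theorem mul_rpow_pow_eq {k e : ℕ} (hk : 2 ≤ k) (x : ℝ) {p : ℝ} (hp : 0 ≤ p) :
    (x * p ^ ((e : ℝ) / ((k : ℝ) - 1))) ^ (k - 1) = x ^ (k - 1) * p ^ e := by
  have hk' : ((k - 1 : ℕ) : ℝ) = (k : ℝ) - 1 := by
    rw [Nat.cast_sub (by omega), Nat.cast_one]
  have h0 : ((k - 1 : ℕ) : ℝ) ≠ 0 := Nat.cast_ne_zero.2 (by omega)
  rw [mul_pow, ← Real.rpow_natCast (p ^ _), ← Real.rpow_mul hp, ← hk', div_mul_cancel₀ _ h0,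
    Real.rpow_natCast]

variable {k n : ℕ} {G : SimpleGraph (Fin k)} [DecidableRel G.Adj]
  {d : ℕ} {Ω : Type*} [MeasurableSpace Ω] {μ : Measure (Fin d → ℝ)}
  {H : (Fin d → ℝ) → (Fin d → ℝ) → ℝ} {p : ℝ} {P : Measure Ω} {X : Fin n → Ω → Fin d → ℝ}
  {Y : Fin n → Fin n → Ω → ℝ} [IsProbabilityMeasure μ] [IsProbabilityMeasure P]

/-- The normalized cumulant bound, given a variance lower bound. -/
theorem IsRCM.cum_NGbar_le_of_variance (h : IsRCM μ H p P X Y) (hbal : StronglyBalanced G)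
    (hk : 2 ≤ k) {j : ℕ} (hj : 3 ≤ j) {a : ℕ} (ha : a ≠ 0) {c T A : ℝ} (hc : 0 < c) (hT : 0 < T)
    (hTD : T * growth k G.edgeFinset.card n p = (n : ℝ) ^ k * p ^ G.edgeFinset.card)
    (hv : c * T * growth k G.edgeFinset.card n p ^ 2 ≤ variance (labelledCount G H p X Y) P)
    (hA : 1 ≤ A) (hA' : Real.exp 1 ^ (1 + k) * (k : ℝ) ^ k / √c ≤ A) :
    cum P j (NGbar P G H p a X Y) ≤
      (j.factorial : ℝ) ^ (1 + k) / ((A ^ 6)⁻¹ * T) ^ ((j : ℝ) / 2 - 1) := by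
  have h1 := h.cum_NGbar_le hbal hk (show 2 ≤ j by omega) a
  have ha' : (0 : ℝ) < a := Nat.cast_pos.2 (Nat.pos_of_ne_zero ha)
  rw [h.variance_NG, Real.sqrt_mul (by positivity), Real.sqrt_sq (by positivity),
    div_mul_eq_div_div, div_self (by positivity), ← hTD] at h1
  exact h1.trans (div_sqrt_pow_mul_le hj hc hT
    (zero_lt_one.trans_le (one_le_growth _ _ _ _)) hv hA hA')

theorem IsRCM.cum_NGbar_le_of_dense (h : IsRCM μ H p P X Y) (hbal : StronglyBalanced G)
    (hk : 2 ≤ k) (hn : 2 * k ≤ n) (hdense : 1 ≤ (n : ℝ) ^ (k - 1) * p ^ G.edgeFinset.card)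
    {j : ℕ} (hj : 3 ≤ j) {a : ℕ} (ha : a ≠ 0) {c A : ℝ} (hc : 0 < c)
    (hcV : c ≤ variance (projSum G H μ) μ / 2 ^ (2 * k)) (hA : 1 ≤ A)
    (hA' : Real.exp 1 ^ (1 + k) * (k : ℝ) ^ k / √c ≤ A) :
    cum P j (NGbar P G H p a X Y) ≤
      (j.factorial : ℝ) ^ (1 + k) / ((A ^ 6)⁻¹ * n) ^ ((j : ℝ) / 2 - 1) := by
  have hn0 : 0 < n := by omega
  have hn' : (0 : ℝ) < n := Nat.cast_pos.2 hn0
  have hg : growth k G.edgeFinset.card n p = (n : ℝ) ^ (k - 1) * p ^ G.edgeFinset.card :=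
    max_eq_right hdense
  have hnk : (n : ℝ) ^ k = n * (n : ℝ) ^ (k - 1) := by
    rw [← pow_succ']
    congr 1
    omega
  have hp0 := h.p_mem.1
  refine h.cum_NGbar_le_of_variance hbal hk hj ha hc hn' (by rw [hg, hnk]; ring) ?_ hA hA'
  have h1 := h.le_variance_of_dense (G := G) hn0
  have h2 : (((n : ℝ) / 2) ^ k * p ^ G.edgeFinset.card) ^ 2 * variance (projSum G H μ) μ ≤
      n * variance (labelledCount G H p X Y) P := by
    refine le_trans ?_ h1
    have := div_two_pow_le_card_injective hn
    have hV := variance_nonneg (projSum G H μ) μ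
    gcongr
  refine le_of_mul_le_mul_left (le_trans ?_ h2) hn'
  rw [hg]
  calc (n : ℝ) * (c * n * ((n : ℝ) ^ (k - 1) * p ^ G.edgeFinset.card) ^ 2)
      = c * ((n : ℝ) ^ k * p ^ G.edgeFinset.card) ^ 2 := by rw [hnk]; ring
    _ ≤ variance (projSum G H μ) μ / 2 ^ (2 * k) * ((n : ℝ) ^ k * p ^ G.edgeFinset.card) ^ 2 := by
        gcongr
    _ = _ := by
        rw [div_pow, mul_comm 2 k, pow_mul]
        ring

theorem IsRCM.cum_NGbar_le_of_sparse (h : IsRCM μ H p P X Y) (hbal : StronglyBalanced G)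
    (hk : 2 ≤ k) (hn : 2 * k ≤ n)
    (hsparse : (k : ℝ) ^ 2 * ((n : ℝ) ^ (k - 1) * p ^ G.edgeFinset.card) ≤ 1 / 2 ^ (k + 1))
    {j : ℕ} (hj : 3 ≤ j) {a : ℕ} (ha : a ≠ 0) {c A : ℝ} (hc : 0 < c)
    (hcG : c ≤ (∫ z, graphWeight G H z ∂(Measure.pi fun _ => μ)) / 2 ^ (k + 1)) (hA : 1 ≤ A)
    (hA' : Real.exp 1 ^ (1 + k) * (k : ℝ) ^ k / √c ≤ A) :
    cum P j (NGbar P G H p a X Y) ≤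
      (j.factorial : ℝ) ^ (1 + k) /
        ((A ^ 6)⁻¹ * ((n : ℝ) ^ k * p ^ G.edgeFinset.card)) ^ ((j : ℝ) / 2 - 1) := by
  have hn' : (0 : ℝ) < n := Nat.cast_pos.2 (by omega)
  have hp0 := h.p_mem.1
  have hG := integral_mem_Icc_zero_one (ν := Measure.pi fun _ : Fin k => μ)
    (graphWeight_mem_Icc (G := G) h.mem_Icc)
  have hsv := h.le_variance_of_sparse (G := G) (by omega) rfl
  generalize ∫ z, graphWeight G H z ∂(Measure.pi fun _ => μ) = w at hG hsv hcG
  have hk1 : (1 : ℝ) ≤ (k : ℝ) ^ 2 := one_le_pow₀ (by exact_mod_cast (by omega : 1 ≤ k))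
  have hy : (n : ℝ) ^ (k - 1) * p ^ G.edgeFinset.card ≤ 1 := by
    calc _ ≤ (k : ℝ) ^ 2 * ((n : ℝ) ^ (k - 1) * p ^ G.edgeFinset.card) :=
          le_mul_of_one_le_left (by positivity) hk1
      _ ≤ 1 / 2 ^ (k + 1) := hsparse
      _ ≤ 1 := div_le_one_of_le₀ (one_le_pow₀ one_le_two) (by positivity)
  have hg : growth k G.edgeFinset.card n p = 1 := max_eq_left hy
  refine h.cum_NGbar_le_of_variance hbal hk hj ha hc (by positivity) (by rw [hg, mul_one]) ?_ hA hA'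
  refine le_trans ?_ hsv
  have hcard := div_two_pow_le_card_injective hn
  set N : ℝ := (Fintype.card {β : Fin k → Fin n // Function.Injective β} : ℝ)
  set x := p ^ G.edgeFinset.card with hx
  have hx0 : 0 < x := by positivity
  rw [hg, one_pow, mul_one]
  have e1 : c * ((n : ℝ) ^ k * x) ≤ w / 2 ^ (k + 1) * ((n : ℝ) ^ k * x) := by gcongr
  have hw := hG.1
  have e2 : ((n : ℝ) / 2) ^ k * (x * w) ≤ N * (x * w) := by gcongr
  have e3 : (n : ℝ) ^ k * ((k : ℝ) ^ 2 * (n : ℝ) ^ (k - 1)) * (x * w) ^ 2 ≤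
      (n : ℝ) ^ k * x * w * (1 / 2 ^ (k + 1)) := by
    calc _ = (n : ℝ) ^ k * x * w * ((k : ℝ) ^ 2 * ((n : ℝ) ^ (k - 1) * x)) * w := by ring
      _ ≤ (n : ℝ) ^ k * x * w * (1 / 2 ^ (k + 1)) * 1 :=
          mul_le_mul (by gcongr) hG.2 hw (by positivity)
      _ = _ := mul_one _
  have e4 : ((n : ℝ) / 2) ^ k * (x * w) - (n : ℝ) ^ k * x * w * (1 / 2 ^ (k + 1)) =
      w / 2 ^ (k + 1) * ((n : ℝ) ^ k * x) := by
    rw [div_pow, pow_succ]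
    field_simp
    ring
  linarith

end Growth

/-- Cumulant growth rates for the normalized count of a strongly balanced connected
graph under Assumption 1: there exist `C > 0` and `n₀` such that for all `n ≥ n₀` and
`j ≥ 3`, `κ_j(N̄_G) ≤ (j!)^{1+v(G)}/(Cn)^{j/2−1}` when `n^{−(v(G)−1)/e(G)} ≪ p_n`, and
`κ_j(N̄_G) ≤ (j!)^{1+v(G)}/(C n^{v(G)} p_n^{e(G)})^{j/2−1}` when
`p_n ≪ n^{−(v(G)−1)/e(G)}`. -/
theorem cumulant_growth_normalized
    {d k : ℕ} (hk : 2 ≤ k)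
    (G : SimpleGraph (Fin k)) [DecidableRel G.Adj] (hGconn : G.Connected)
    (μ : Measure (Fin d → ℝ)) [IsProbabilityMeasure μ] (hμ : ∀ x, μ {x} = 0)
    (H : (Fin d → ℝ) → (Fin d → ℝ) → ℝ)
    (hHm : Measurable fun z : (Fin d → ℝ) × (Fin d → ℝ) => H z.1 z.2)
    (hHsym : ∀ x y, H x y = H y x) (hH01 : ∀ x y, H x y ∈ Set.Icc (0 : ℝ) 1)
    (p : ℕ → ℝ) (hp : ∀ n, p n ∈ Set.Ioo (0 : ℝ) 1)
    (Ω : ℕ → Type) [∀ n, MeasurableSpace (Ω n)]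
    (P : ∀ n, Measure (Ω n)) [∀ n, IsProbabilityMeasure (P n)]
    (X : ∀ n, Fin n → Ω n → (Fin d → ℝ)) (Y : ∀ n, Fin n → Fin n → Ω n → ℝ)
    (hYsym : ∀ n a b, Y n a b = Y n b a)
    (hlaw : ∀ n, Measure.map (fun ω => ((fun i => X n i ω),
        (fun q : {q : Fin n × Fin n // q.1 < q.2} => Y n q.1.1 q.1.2 ω))) (P n)
      = (Measure.pi fun _ => μ).prod
          (Measure.pi fun _ => (volume.restrict (Set.Icc (0 : ℝ) 1))))
    (hbal : StronglyBalanced G)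
    (hA : ∀ n, 0 < variance
      (fun x => ∑ ℓ : Fin k, fSub G H μ (p n) (autCard G) ℓ x) μ) :
    ∃ C > (0 : ℝ), ∃ n₀ : ℕ,
      (Filter.Tendsto
          (fun n : ℕ => (n : ℝ) * p n ^ ((G.edgeFinset.card : ℝ) / ((k : ℝ) - 1)))
          Filter.atTop Filter.atTop →
        ∀ n, n₀ ≤ n → ∀ j, 3 ≤ j →
          cum (P n) j (NGbar (P n) G H (p n) (autCard G) (X n) (Y n))
            ≤ (j.factorial : ℝ) ^ (1 + k) / (C * (n : ℝ)) ^ ((j : ℝ) / 2 - 1))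
      ∧ (Filter.Tendsto
          (fun n : ℕ => (n : ℝ) * p n ^ ((G.edgeFinset.card : ℝ) / ((k : ℝ) - 1)))
          Filter.atTop (nhds 0) →
        ∀ n, n₀ ≤ n → ∀ j, 3 ≤ j →
          cum (P n) j (NGbar (P n) G H (p n) (autCard G) (X n) (Y n))
            ≤ (j.factorial : ℝ) ^ (1 + k) /
                (C * (n : ℝ) ^ k * p n ^ G.edgeFinset.card) ^ ((j : ℝ) / 2 - 1)) := by
  have hrcm : ∀ n, IsRCM μ H (p n) (P n) (X n) (Y n) := fun n =>
    ⟨hHm, hHsym, hH01, hp n, hYsym n, hlaw n⟩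
  have hA0 := hA 0
  rw [variance_sum_fSub G hHsym] at hA0
  have ha : autCard G ≠ 0 := by
    intro h0
    simp [h0] at hA0
  have hV : 0 < variance (projSum G H μ) μ := pos_of_mul_pos_right hA0 (sq_nonneg _)
  have hw : 0 < ∫ z, graphWeight G H z ∂(Measure.pi fun _ => μ) :=
    pos_of_mul_pos_right (hV.trans_le (variance_projSum_le hHm hH01)) (sq_nonneg _)
  set V := variance (projSum G H μ) μ
  set w := ∫ z, graphWeight G H z ∂(Measure.pi fun _ => μ)
  set c := min (V / 2 ^ (2 * k)) (w / 2 ^ (k + 1))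
  have hc : 0 < c := lt_min (by positivity) (by positivity)
  set A := max 1 (Real.exp 1 ^ (1 + k) * (k : ℝ) ^ k / √c)
  have hA1 : 1 ≤ A := le_max_left _ _
  have hA2 : Real.exp 1 ^ (1 + k) * (k : ℝ) ^ k / √c ≤ A := le_max_right _ _
  have hpow : ∀ n : ℕ, ((n : ℝ) * p n ^ ((G.edgeFinset.card : ℝ) / ((k : ℝ) - 1))) ^ (k - 1) =
      (n : ℝ) ^ (k - 1) * p n ^ G.edgeFinset.card := fun n => mul_rpow_pow_eq hk _ (hp n).1.le
  obtain ⟨n₁, hn₁⟩ : ∃ n₁ : ℕ, Filter.Tendsto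
      (fun n : ℕ => (n : ℝ) * p n ^ ((G.edgeFinset.card : ℝ) / ((k : ℝ) - 1)))
      Filter.atTop Filter.atTop →
        ∀ n, n₁ ≤ n → 1 ≤ (n : ℝ) ^ (k - 1) * p n ^ G.edgeFinset.card := by
    by_cases ht : Filter.Tendsto
      (fun n : ℕ => (n : ℝ) * p n ^ ((G.edgeFinset.card : ℝ) / ((k : ℝ) - 1)))
      Filter.atTop Filter.atTop
    · obtain ⟨n₁, h⟩ := Filter.eventually_atTop.1 (ht.eventually_ge_atTop 1)
      exact ⟨n₁, fun _ n hn => hpow n ▸ one_le_pow₀ (h n hn)⟩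
    · exact ⟨0, fun h => absurd h ht⟩
  obtain ⟨n₂, hn₂⟩ : ∃ n₂ : ℕ, Filter.Tendsto
      (fun n : ℕ => (n : ℝ) * p n ^ ((G.edgeFinset.card : ℝ) / ((k : ℝ) - 1)))
      Filter.atTop (nhds 0) → ∀ n, n₂ ≤ n →
        (k : ℝ) ^ 2 * ((n : ℝ) ^ (k - 1) * p n ^ G.edgeFinset.card) ≤ 1 / 2 ^ (k + 1) := by
    by_cases ht : Filter.Tendsto
      (fun n : ℕ => (n : ℝ) * p n ^ ((G.edgeFinset.card : ℝ) / ((k : ℝ) - 1)))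
      Filter.atTop (nhds 0)
    · have ht' := (ht.pow (k - 1)).const_mul ((k : ℝ) ^ 2)
      rw [zero_pow (by omega), mul_zero] at ht'
      obtain ⟨n₂, h⟩ := Filter.eventually_atTop.1
        (ht'.eventually_le_const (show (0 : ℝ) < 1 / 2 ^ (k + 1) by positivity))
      exact ⟨n₂, fun _ n hn => hpow n ▸ h n hn⟩
    · exact ⟨0, fun h => absurd h ht⟩
  refine ⟨(A ^ 6)⁻¹, by positivity, max (2 * k) (max n₁ n₂), ?_, ?_⟩
  · intro ht n hn j hj
    exact (hrcm n).cum_NGbar_le_of_dense hbal hk ((le_max_left _ _).trans hn)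
      (hn₁ ht n ((le_max_left _ _).trans ((le_max_right _ _).trans hn))) hj ha hc
      (min_le_left _ _) hA1 hA2
  · intro ht n hn j hj
    rw [mul_assoc]
    exact (hrcm n).cum_NGbar_le_of_sparse hbal hk ((le_max_left _ _).trans hn)
      (hn₂ ht n ((le_max_right _ _).trans ((le_max_right _ _).trans hn))) hj ha hc
      (min_le_right _ _) hA1 hA2
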